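/- Linear stability of the IMEX-E scheme (Theorem 3.3): Let 0<β<1, λ, ρ ∈ ℂ with ρ = kλ for some k ∈ ℝ, and h>0. Let m_u, m̃_f be nonnegative integers, m = max{m_u, m̃_f}, and let 0<σ_1<⋯<σ_{m_u} ≤ 2−β and 0<δ_1<⋯<δ_{m̃_f} ≤ 2−β be exponents. Suppose the complex sequence (U_n)_{n≥0} satisfies, for all n ≥ max{2, m+1}, the recurrence U_n = U_0 + (λ+ρ)h^β[Σ_{j=0}^{n} ω_{n−j}^{(β)} U_j + Σ_{j=1}^{m_u} W_{n,j}^{(β,σ)} U_j + B_n^σ U_0] + ρ h^β ω_0^{(β)}[−U_n + 2U_{n−1} − U_{n−2} + Σ_{j=1}^{m̃_f} Ŵ_{n,j}^{(f)}(U_j − U_0)]. Let ω^{(β)}(z) = Σ_{n=0}^∞ ω_n^{(β)} z^n, which converges for |z|<1. If ξ = λh^β satisfies inf_{|z|<1} |1 − ξ((k+1)ω^{(β)}(z) − k ω_0^{(β)}(1−z)^2)| > 0, then for every choice of starting values U_0, U_1, …, U_{max{1,m}}, the sequence (U_n)_{n≥0} is bounded. -/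

import Mathlib

/-- Generalized binomial coefficient `C(β,i) = β(β−1)⋯(β−i+1)/i!`. -/
noncomputable def genBinom (β : ℝ) (i : ℕ) : ℝ :=
  (∏ j ∈ Finset.range i, (β - (j : ℝ))) / (Nat.factorial i : ℝ)

/-- Taylor coefficients of the generating function `((1+z)/(2(1−z)))^β`. -/
noncomputable def omegaCoef (β : ℝ) (j : ℕ) : ℝ :=
  (2 : ℝ) ^ (-β) * ∑ i ∈ Finset.range (j + 1),
    genBinom β i * Real.Gamma (β + ((j - i : ℕ) : ℝ)) /
      (Real.Gamma β * (Nat.factorial (j - i) : ℝ))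

/-- The generating function `ω^{(β)}(z) = Σ ω_n^{(β)} z^n` on the unit disk. -/
noncomputable def omegaFnC (β : ℝ) (z : ℂ) : ℂ :=
  ∑' n : ℕ, (omegaCoef β n : ℂ) * z ^ n

/-- `W` solves the Vandermonde system defining the starting weights
`W_{n,j}^{(β,σ)}`, `j = 1,…,m`. -/
def IsStartWeights (β : ℝ) (σ : ℕ → ℝ) (m n : ℕ) (W : ℕ → ℝ) : Prop :=
  ∀ r ∈ Finset.Icc 1 m,
    ∑ j ∈ Finset.Icc 1 m, W j * (j : ℝ) ^ (σ r) =
      Real.Gamma (σ r + 1) / Real.Gamma (σ r + 1 + β) * (n : ℝ) ^ (σ r + β) -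
        ∑ j ∈ Finset.range (n + 1), omegaCoef β (n - j) * (j : ℝ) ^ (σ r)

/-- `B_n^σ` completing the starting weights. -/
noncomputable def Bweight (β : ℝ) (ω W : ℕ → ℝ) (m n : ℕ) : ℝ :=
  (n : ℝ) ^ β / Real.Gamma (1 + β) - ∑ j ∈ Finset.range (n + 1), ω (n - j) -
    ∑ j ∈ Finset.Icc 1 m, W j

/-- `W` solves the Vandermonde system defining the extrapolation correction
weights `Ŵ_{n,j}^{(f)}`, `j = 1,…,m̃_f`. -/
def IsExtrapWeights (δ : ℕ → ℝ) (m n : ℕ) (W : ℕ → ℝ) : Prop :=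
  ∀ r ∈ Finset.Icc 1 m,
    ∑ j ∈ Finset.Icc 1 m, W j * (j : ℝ) ^ (δ r) =
      (n : ℝ) ^ (δ r) - 2 * ((n : ℝ) - 1) ^ (δ r) + ((n : ℝ) - 2) ^ (δ r)

section PowerSeriesStability

open Filter Topology BoundedContinuousFunction

/-- A power series with bounded coefficients. -/
def BddCoeff (f : PowerSeries ℂ) : Prop :=
  ∃ C : ℝ, ∀ n, ‖PowerSeries.coeff n f‖ ≤ C

/-- A power series with absolutely summable coefficients. -/
def AbsSummable (f : PowerSeries ℂ) : Prop :=
  Summable fun n => ‖PowerSeries.coeff n f‖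

/-- The right shift on bounded sequences. -/
noncomputable def shiftCLM : (ℕ →ᵇ ℂ) →L[ℂ] (ℕ →ᵇ ℂ) :=
  LinearMap.mkContinuous
    { toFun := fun v => BoundedContinuousFunction.ofNormedAddCommGroupDiscrete
        (fun n => if n = 0 then 0 else v (n - 1)) ‖v‖ (fun n => by
          split_ifs
          · simp
          · exact v.norm_coe_le_norm _)
      map_add' := fun v w => by
        ext n
        by_cases hn : n = 0 <;> simp [hn]
      map_smul' := fun a v => by
        ext n
        by_cases hn : n = 0 <;> simp [hn] } 1 (fun v => by
    rw [one_mul]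
    refine (BoundedContinuousFunction.norm_le (norm_nonneg v)).2 fun n => ?_
    by_cases hn : n = 0
    · simp [hn]
    · simpa [hn] using v.norm_coe_le_norm _)

theorem shiftCLM_apply (v : ℕ →ᵇ ℂ) (n : ℕ) :
    shiftCLM v n = if n = 0 then 0 else v (n - 1) := rfl

theorem shiftCLM_pow_apply (i : ℕ) (v : ℕ →ᵇ ℂ) (n : ℕ) :
    (shiftCLM ^ i) v n = if n < i then 0 else v (n - i) := by
  induction i generalizing n with
  | zero => simp
  | succ i ih =>
    rw [pow_succ']
    change shiftCLM ((shiftCLM ^ i) v) n = _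
    rw [shiftCLM_apply]
    rcases n with _ | n
    · simp
    · rw [if_neg n.succ_ne_zero, Nat.add_sub_cancel, ih]
      simp

theorem norm_shiftCLM_le : ‖shiftCLM‖ ≤ 1 := LinearMap.mkContinuous_norm_le _ zero_le_one _

theorem isUnit_tsum_smul_pow {A : Type*} [NormedCommRing A] [NormedAlgebra ℂ A] [CompleteSpace A]
    [NormOneClass A] {s : A} (hs : ‖s‖ ≤ 1) {p : ℕ → ℂ} (hp : Summable fun n => ‖p n‖)
    (hp0 : ∀ z : ℂ, ‖z‖ ≤ 1 → ∑' n, p n * z ^ n ≠ 0) :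
    Summable (fun n => p n • s ^ n) ∧ IsUnit (∑' n, p n • s ^ n) := by
  have hsum : Summable fun n => p n • s ^ n := by
    refine Summable.of_norm_bounded hp fun n => ?_
    rw [norm_smul]
    refine mul_le_of_le_one_right (norm_nonneg _) ?_
    exact (norm_pow_le s n).trans (pow_le_one₀ (norm_nonneg _) hs)
  refine ⟨hsum, ?_⟩
  by_contra h0
  obtain ⟨φ, hφ⟩ := WeakDual.CharacterSpace.exists_apply_eq_zero h0
  refine hp0 (φ s) ((AlgHom.norm_apply_le_self φ s).trans hs) ?_
  rw [← hφ, ← (hsum.hasSum.map φ (map_continuous φ)).tsum_eq]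
  simp

theorem exists_right_inv_tsum_smul_pow {B : Type*} [NormedRing B] [NormedAlgebra ℂ B]
    [CompleteSpace B] [NormOneClass B] {s : B} (hs : ‖s‖ ≤ 1) {p : ℕ → ℂ}
    (hp : Summable fun n => ‖p n‖) (hp0 : ∀ z : ℂ, ‖z‖ ≤ 1 → ∑' n, p n * z ^ n ≠ 0) :
    ∃ T G : B, HasSum (fun n => p n • s ^ n) T ∧ T * G = 1 := by
  let _ : NormedCommRing (Algebra.elemental ℂ s) :=
    { SubringClass.toNormedRing (Algebra.elemental ℂ s) with
      mul_comm := mul_comm }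
  have : NormOneClass (Algebra.elemental ℂ s) := ⟨norm_one (α := B)⟩
  let s' : Algebra.elemental ℂ s := ⟨s, Algebra.elemental.self_mem ℂ _⟩
  obtain ⟨h1, h2⟩ := isUnit_tsum_smul_pow (s := s') hs hp hp0
  obtain ⟨G, hG⟩ := h2.exists_right_inv
  exact ⟨_, G, h1.hasSum.map (Subalgebra.val _) continuous_subtype_val,
    congrArg Subtype.val hG⟩

/-- **Wiener's lemma** for power series, as a statement about sequences: if `f` has absolutely
summable coefficients and no zero in the closed unit disk, then a power series `u` for which
`f * u` has bounded coefficients has bounded coefficients. -/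
theorem bddCoeff_of_mul_bddCoeff {f u : PowerSeries ℂ} (hf : AbsSummable f)
    (hf0 : ∀ z : ℂ, ‖z‖ ≤ 1 → ∑' n, PowerSeries.coeff n f * z ^ n ≠ 0)
    (hfu : BddCoeff (f * u)) : BddCoeff u := by
  have : Nontrivial (ℕ →ᵇ ℂ) := ⟨⟨0, BoundedContinuousFunction.const ℕ 1, fun h => by
    simpa using DFunLike.congr_fun h 0⟩⟩
  obtain ⟨T, G, hT, hTG⟩ := exists_right_inv_tsum_smul_pow
    (B := (ℕ →ᵇ ℂ) →L[ℂ] (ℕ →ᵇ ℂ)) norm_shiftCLM_le hf hf0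
  have hTapp : ∀ (w : ℕ →ᵇ ℂ) (n : ℕ),
      T w n = PowerSeries.coeff n (f * PowerSeries.mk w) := by
    intro w n
    have h1 : HasSum (fun i => PowerSeries.coeff i f • (shiftCLM ^ i) w n) (T w n) :=
      hT.map ((BoundedContinuousFunction.evalCLM ℂ n).comp
        (ContinuousLinearMap.apply ℂ (ℕ →ᵇ ℂ) w)) (ContinuousLinearMap.continuous _)
    rw [← h1.tsum_eq, PowerSeries.coeff_mul, Finset.Nat.sum_antidiagonal_eq_sum_range_succ_mk,
      tsum_eq_sum (s := Finset.range (n + 1))]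
    · refine Finset.sum_congr rfl fun i hi => ?_
      rw [shiftCLM_pow_apply, if_neg (by simpa using Finset.mem_range_succ_iff.1 hi)]
      simp
    · intro i hi
      rw [shiftCLM_pow_apply, if_pos (by simpa using hi), smul_zero]
  obtain ⟨C, hC⟩ := hfu
  let g : ℕ →ᵇ ℂ := BoundedContinuousFunction.ofNormedAddCommGroupDiscrete
    (fun n => PowerSeries.coeff n (f * u)) C hC
  have hTV : T (G g) = g := DFunLike.congr_fun hTG g
  have hfV : f * PowerSeries.mk (G g) = f * u := by
    ext n
    rw [← hTapp, hTV]
    rfl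
  have hfne : f ≠ 0 := by
    rintro rfl
    exact hf0 0 (by simp) (by simp)
  refine ⟨‖G g‖, fun n => ?_⟩
  rw [← mul_left_cancel₀ hfne hfV, PowerSeries.coeff_mk]
  exact (G g).norm_coe_le_norm n

/-- The sum of a power series at a point. -/
noncomputable def evalAt (z : ℂ) (f : PowerSeries ℂ) : ℂ :=
  ∑' n, PowerSeries.coeff n f * z ^ n

/-- Absolute convergence of a power series at a point. -/
def SummableAt (z : ℂ) (f : PowerSeries ℂ) : Prop :=
  Summable fun n => ‖PowerSeries.coeff n f * z ^ n‖

namespace SummableAt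

variable {z : ℂ} {f g : PowerSeries ℂ}

theorem add (hf : SummableAt z f) (hg : SummableAt z g) : SummableAt z (f + g) := by
  refine Summable.of_nonneg_of_le (fun n => norm_nonneg _) (fun n => ?_) (Summable.add hf hg)
  rw [map_add, add_mul]
  exact norm_add_le _ _

theorem C_mul (a : ℂ) (hf : SummableAt z f) : SummableAt z (PowerSeries.C a * f) := by
  refine (Summable.mul_left ‖a‖ hf).congr fun n => ?_
  rw [PowerSeries.coeff_C_mul, mul_assoc, norm_mul a]

theorem neg (hf : SummableAt z f) : SummableAt z (-f) := by
  refine Summable.congr hf fun n => ?_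
  simp

theorem sub (hf : SummableAt z f) (hg : SummableAt z g) : SummableAt z (f - g) := by
  rw [sub_eq_add_neg]
  exact hf.add hg.neg

theorem coeff_mul_mul_pow (f g : PowerSeries ℂ) (z : ℂ) (n : ℕ) :
    PowerSeries.coeff n (f * g) * z ^ n = ∑ p ∈ Finset.HasAntidiagonal.antidiagonal n,
      (PowerSeries.coeff p.1 f * z ^ p.1) * (PowerSeries.coeff p.2 g * z ^ p.2) := by
  rw [PowerSeries.coeff_mul, Finset.sum_mul]
  refine Finset.sum_congr rfl fun p hp => ?_
  rw [← Finset.HasAntidiagonal.mem_antidiagonal.1 hp, pow_add]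
  ring

theorem mul (hf : SummableAt z f) (hg : SummableAt z g) : SummableAt z (f * g) := by
  refine (summable_norm_sum_mul_antidiagonal_of_summable_norm hf hg).congr fun n => ?_
  rw [coeff_mul_mul_pow]

end SummableAt

theorem summableAt_polynomial (z : ℂ) (p : Polynomial ℂ) :
    SummableAt z (p : PowerSeries ℂ) := by
  refine summable_of_ne_finset_zero (s := p.support) fun n hn => ?_
  simp [Polynomial.notMem_support_iff.1 hn]

theorem evalAt_polynomial (z : ℂ) (p : Polynomial ℂ) :
    evalAt z (p : PowerSeries ℂ) = p.eval z := by
  rw [evalAt, tsum_eq_sum (s := p.support), Polynomial.eval_eq_sum, Polynomial.sum]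
  · simp
  · intro n hn
    simp [Polynomial.notMem_support_iff.1 hn]

theorem coe_one_sub_X :
    ((1 - Polynomial.X : Polynomial ℂ) : PowerSeries ℂ) = 1 - PowerSeries.X := by
  rw [Polynomial.coe_sub, Polynomial.coe_one, Polynomial.coe_X]

theorem summableAt_one_sub_X (z : ℂ) : SummableAt z (1 - PowerSeries.X) := by
  rw [← coe_one_sub_X]
  exact summableAt_polynomial z _

theorem summableAt_one (z : ℂ) : SummableAt z 1 := by
  simpa using summableAt_polynomial z 1

theorem evalAt_one_sub_X (z : ℂ) : evalAt z (1 - PowerSeries.X) = 1 - z := by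
  rw [← coe_one_sub_X, evalAt_polynomial]
  simp

theorem evalAt_one (z : ℂ) : evalAt z 1 = 1 := by
  simpa using evalAt_polynomial z 1

theorem evalAt_add {z : ℂ} {f g : PowerSeries ℂ} (hf : SummableAt z f) (hg : SummableAt z g) :
    evalAt z (f + g) = evalAt z f + evalAt z g := by
  simp only [evalAt, map_add, add_mul]
  exact (Summable.of_norm hf).tsum_add (Summable.of_norm hg)

theorem evalAt_C_mul (z a : ℂ) (f : PowerSeries ℂ) :
    evalAt z (PowerSeries.C a * f) = a * evalAt z f := by
  simp only [evalAt, PowerSeries.coeff_C_mul, mul_assoc, tsum_mul_left]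

theorem evalAt_neg (z : ℂ) (f : PowerSeries ℂ) : evalAt z (-f) = -evalAt z f := by
  simp [evalAt, tsum_neg]

theorem evalAt_sub {z : ℂ} {f g : PowerSeries ℂ} (hf : SummableAt z f) (hg : SummableAt z g) :
    evalAt z (f - g) = evalAt z f - evalAt z g := by
  rw [sub_eq_add_neg, evalAt_add hf hg.neg, evalAt_neg, sub_eq_add_neg]

theorem evalAt_mul {z : ℂ} {f g : PowerSeries ℂ} (hf : SummableAt z f) (hg : SummableAt z g) :
    evalAt z (f * g) = evalAt z f * evalAt z g := by
  simp only [evalAt, SummableAt.coeff_mul_mul_pow]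
  exact (tsum_mul_tsum_eq_tsum_sum_antidiagonal_of_summable_norm hf hg).symm

theorem absSummable_iff_summableAt_one {f : PowerSeries ℂ} : AbsSummable f ↔ SummableAt 1 f := by
  simp [AbsSummable, SummableAt]

namespace AbsSummable

variable {f g : PowerSeries ℂ}

theorem summableAt (hf : AbsSummable f) {z : ℂ} (hz : ‖z‖ ≤ 1) : SummableAt z f := by
  refine Summable.of_nonneg_of_le (fun n => norm_nonneg _) (fun n => ?_) hf
  rw [norm_mul, norm_pow]
  exact mul_le_of_le_one_right (norm_nonneg _) (pow_le_one₀ (norm_nonneg _) hz)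

theorem add (hf : AbsSummable f) (hg : AbsSummable g) : AbsSummable (f + g) := by
  rw [absSummable_iff_summableAt_one] at *
  exact hf.add hg

theorem sub (hf : AbsSummable f) (hg : AbsSummable g) : AbsSummable (f - g) := by
  rw [absSummable_iff_summableAt_one] at *
  exact hf.sub hg

theorem mul (hf : AbsSummable f) (hg : AbsSummable g) : AbsSummable (f * g) := by
  rw [absSummable_iff_summableAt_one] at *
  exact hf.mul hg

theorem C_mul (a : ℂ) (hf : AbsSummable f) : AbsSummable (PowerSeries.C a * f) := by
  rw [absSummable_iff_summableAt_one] at *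
  exact hf.C_mul a

theorem one_sub_X : AbsSummable (1 - PowerSeries.X) :=
  absSummable_iff_summableAt_one.2 (summableAt_one_sub_X 1)

theorem one : AbsSummable 1 :=
  absSummable_iff_summableAt_one.2 (summableAt_one 1)

theorem continuousOn_evalAt (hf : AbsSummable f) :
    ContinuousOn (fun z => evalAt z f) (Metric.closedBall 0 1) := by
  refine continuousOn_tsum (fun n => by fun_prop) hf fun n z hz => ?_
  rw [norm_mul, norm_pow]
  exact mul_le_of_le_one_right (norm_nonneg _)
    (pow_le_one₀ (norm_nonneg _) (mem_closedBall_zero_iff.1 hz))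

end AbsSummable

namespace BddCoeff

variable {f g : PowerSeries ℂ}

theorem add (hf : BddCoeff f) (hg : BddCoeff g) : BddCoeff (f + g) := by
  obtain ⟨C, hC⟩ := hf
  obtain ⟨D, hD⟩ := hg
  exact ⟨C + D, fun n => by
    rw [map_add]
    exact (norm_add_le _ _).trans (add_le_add (hC n) (hD n))⟩

theorem C_mul (a : ℂ) (hf : BddCoeff f) : BddCoeff (PowerSeries.C a * f) := by
  obtain ⟨C, hC⟩ := hf
  exact ⟨‖a‖ * C, fun n => by
    rw [PowerSeries.coeff_C_mul, norm_mul]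
    exact mul_le_mul_of_nonneg_left (hC n) (norm_nonneg a)⟩

theorem neg (hf : BddCoeff f) : BddCoeff (-f) := by
  simpa using hf.C_mul (-1)

theorem sub (hf : BddCoeff f) (hg : BddCoeff g) : BddCoeff (f - g) := by
  rw [sub_eq_add_neg]
  exact hf.add hg.neg

theorem mul_left (hf : AbsSummable f) (hg : BddCoeff g) : BddCoeff (f * g) := by
  obtain ⟨C, hC⟩ := hg
  have hC0 : 0 ≤ C := (norm_nonneg _).trans (hC 0)
  refine ⟨(∑' n, ‖PowerSeries.coeff n f‖) * C, fun n => ?_⟩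
  rw [PowerSeries.coeff_mul, Finset.Nat.sum_antidiagonal_eq_sum_range_succ_mk]
  calc ‖∑ k ∈ Finset.range n.succ, PowerSeries.coeff k f * PowerSeries.coeff (n - k) g‖
      ≤ ∑ k ∈ Finset.range n.succ, ‖PowerSeries.coeff k f‖ * C := by
        refine norm_sum_le_of_le _ fun k _ => ?_
        rw [norm_mul]
        exact mul_le_mul_of_nonneg_left (hC _) (norm_nonneg _)
    _ ≤ (∑' n, ‖PowerSeries.coeff n f‖) * C := by
        rw [← Finset.sum_mul]
        exact mul_le_mul_of_nonneg_right
          (hf.sum_le_tsum _ fun _ _ => norm_nonneg _) hC0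

theorem summableAt (hf : BddCoeff f) {z : ℂ} (hz : ‖z‖ < 1) : SummableAt z f := by
  obtain ⟨C, hC⟩ := hf
  refine Summable.of_nonneg_of_le (fun n => norm_nonneg _) (fun n => ?_)
    ((summable_geometric_of_lt_one (norm_nonneg z) hz).mul_left C)
  rw [norm_mul, norm_pow]
  exact mul_le_mul_of_nonneg_right (hC n) (pow_nonneg (norm_nonneg z) n)

end BddCoeff

theorem genBinom_succ (s : ℝ) (n : ℕ) :
    genBinom s (n + 1) = genBinom s n * ((s - n) / (n + 1)) := by
  have : (Nat.factorial n : ℝ) ≠ 0 := by positivity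
  have h2 : (n : ℝ) + 1 ≠ 0 := by positivity
  rw [genBinom, genBinom, Finset.prod_range_succ, Nat.factorial_succ]
  push_cast
  field_simp

theorem genBinom_eq_choose (s : ℝ) (n : ℕ) : genBinom s n = Ring.choose s n := by
  rw [Ring.choose_eq_smul, Polynomial.descPochhammer_smeval_eq_ascPochhammer,
    Polynomial.ascPochhammer_smeval_eq_eval, ← descPochhammer_eval_eq_ascPochhammer,
    descPochhammer_eval_eq_prod_range, genBinom, smul_eq_mul, div_eq_inv_mul]

/-- The power series of `(1 + X) ^ s`. -/
noncomputable def binSeries (s : ℝ) : PowerSeries ℂ :=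
  PowerSeries.mk fun n => (genBinom s n : ℂ)

theorem binSeries_eq (s : ℝ) : binSeries s = PowerSeries.binomialSeries ℂ s := by
  ext n
  simp [binSeries, genBinom_eq_choose]

theorem binSeries_add (s t : ℝ) : binSeries (s + t) = binSeries s * binSeries t := by
  simp only [binSeries_eq, PowerSeries.binomialSeries_add]

theorem binSeries_one : binSeries 1 = 1 + PowerSeries.X := by
  simpa [binSeries_eq] using PowerSeries.binomialSeries_nat (R := ℝ) (A := ℂ) 1

theorem binSeries_zero : binSeries 0 = 1 := by
  rw [binSeries_eq, PowerSeries.binomialSeries_zero]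

/-- The Taylor coefficients of `(1 - z) ^ (-s)`. -/
noncomputable def risingCoef (s : ℝ) (n : ℕ) : ℝ :=
  (∏ j ∈ Finset.range n, (s + (j : ℝ))) / (Nat.factorial n : ℝ)

theorem risingCoef_zero (s : ℝ) : risingCoef s 0 = 1 := by simp [risingCoef]

theorem risingCoef_succ (s : ℝ) (n : ℕ) :
    risingCoef s (n + 1) = risingCoef s n * ((s + n) / (n + 1)) := by
  have : (Nat.factorial n : ℝ) ≠ 0 := by positivity
  have h2 : (n : ℝ) + 1 ≠ 0 := by positivity
  rw [risingCoef, risingCoef, Finset.prod_range_succ, Nat.factorial_succ]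
  push_cast
  field_simp

theorem risingCoef_eq (s : ℝ) (n : ℕ) : risingCoef s n = (-1) ^ n * genBinom (-s) n := by
  induction n with
  | zero => simp [risingCoef, genBinom]
  | succ n ih =>
    rw [risingCoef_succ, genBinom_succ, ih]
    ring

theorem risingCoef_pos {s : ℝ} (hs : 0 < s) (n : ℕ) : 0 < risingCoef s n := by
  unfold risingCoef
  have : 0 < ∏ j ∈ Finset.range n, (s + (j : ℝ)) := Finset.prod_pos fun j _ => by positivity
  positivity

theorem risingCoef_eq_Gamma {s : ℝ} (hs : 0 < s) (n : ℕ) :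
    risingCoef s n = Real.Gamma (s + n) / (Real.Gamma s * Nat.factorial n) := by
  have hG := (Real.Gamma_pos_of_pos hs).ne'
  induction n with
  | zero => simp [risingCoef, hG]
  | succ n ih =>
    have : (Nat.factorial n : ℝ) ≠ 0 := by positivity
    have h2 : (n : ℝ) + 1 ≠ 0 := by positivity
    rw [risingCoef_succ, ih, Nat.factorial_succ, Nat.cast_succ, ← add_assoc,
      Real.Gamma_add_one (by positivity)]
    push_cast
    field_simp

theorem add_mul_risingCoef (s : ℝ) (n : ℕ) :
    (s + n) * risingCoef s n = s * risingCoef (s + 1) n := by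
  induction n with
  | zero => simp [risingCoef_zero]
  | succ n ih =>
    rw [risingCoef_succ, risingCoef_succ, ← mul_assoc s, ← ih]
    push_cast
    ring

theorem abs_risingCoef_le_one {s : ℝ} (hs : -1 ≤ s) (hs1 : s ≤ 1) (n : ℕ) :
    |risingCoef s n| ≤ 1 := by
  induction n with
  | zero => simp [risingCoef_zero]
  | succ n ih =>
    rw [risingCoef_succ, abs_mul]
    refine mul_le_one₀ ih (abs_nonneg _) ?_
    have hn : (0 : ℝ) ≤ n := n.cast_nonneg
    rw [abs_div, abs_of_pos (show (0 : ℝ) < n + 1 by positivity), div_le_one (by positivity),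
      abs_le]
    constructor <;> linarith

/-- The power series of `(1 - X) ^ (-s)`. -/
noncomputable def risingSeries (s : ℝ) : PowerSeries ℂ :=
  PowerSeries.mk fun n => (risingCoef s n : ℂ)

theorem coeff_risingSeries (s : ℝ) (n : ℕ) :
    PowerSeries.coeff n (risingSeries s) = (risingCoef s n : ℂ) := PowerSeries.coeff_mk _ _

theorem risingSeries_eq (s : ℝ) :
    risingSeries s = PowerSeries.rescale (-1) (binSeries (-s)) := by
  ext n
  simp [risingSeries, binSeries, risingCoef_eq]

theorem risingSeries_add (s t : ℝ) :
    risingSeries (s + t) = risingSeries s * risingSeries t := by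
  rw [risingSeries_eq, neg_add, binSeries_add, map_mul, ← risingSeries_eq, ← risingSeries_eq]

theorem risingSeries_zero : risingSeries 0 = 1 := by
  rw [risingSeries_eq, neg_zero, binSeries_zero, map_one]

theorem risingSeries_neg_one : risingSeries (-1) = 1 - PowerSeries.X := by
  rw [risingSeries_eq, neg_neg, binSeries_one, map_add, map_one, PowerSeries.rescale_X]
  simp [sub_eq_add_neg]

theorem risingSeries_sub_one (s : ℝ) :
    risingSeries (s - 1) = (1 - PowerSeries.X) * risingSeries s := by
  rw [sub_eq_neg_add, risingSeries_add, risingSeries_neg_one]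

theorem bddCoeff_risingSeries {s : ℝ} (hs : -1 ≤ s) (hs1 : s ≤ 1) :
    BddCoeff (risingSeries s) :=
  ⟨1, fun n => by
    rw [coeff_risingSeries, Complex.norm_real, Real.norm_eq_abs]
    exact abs_risingCoef_le_one hs hs1 n⟩

theorem risingCoef_neg_nonpos {β : ℝ} (hβ0 : 0 ≤ β) (hβ1 : β ≤ 1) (n : ℕ) :
    risingCoef (-β) (n + 1) ≤ 0 := by
  induction n with
  | zero => simpa [risingCoef] using hβ0
  | succ n ih =>
    rw [risingCoef_succ]
    have hn : (0 : ℝ) ≤ n := n.cast_nonneg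
    refine mul_nonpos_of_nonpos_of_nonneg ih (div_nonneg ?_ (by positivity))
    push_cast
    linarith

theorem sum_risingCoef (s : ℝ) (n : ℕ) :
    ∑ i ∈ Finset.range (n + 1), risingCoef s i = risingCoef (s + 1) n := by
  induction n with
  | zero => simp [risingCoef_zero]
  | succ n ih =>
    rw [Finset.sum_range_succ, ih, risingCoef_succ, risingCoef_succ]
    have h2 : (n : ℝ) + 1 ≠ 0 := by positivity
    have := add_mul_risingCoef s n
    rw [mul_div_assoc', mul_comm (risingCoef s n), this]
    field_simp
    ring

theorem sum_neg_risingCoef_le {β : ℝ} (hβ1 : β < 1) (n : ℕ) :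
    ∑ i ∈ Finset.range n, -risingCoef (-β) (i + 1) ≤ 1 := by
  have h := sum_risingCoef (-β) n
  rw [Finset.sum_range_succ', risingCoef_zero] at h
  have := risingCoef_pos (show 0 < -β + 1 by linarith) n
  rw [Finset.sum_neg_distrib]
  linarith

theorem summable_risingCoef_neg {β : ℝ} (hβ0 : 0 < β) (hβ1 : β < 1) :
    Summable fun n => -risingCoef (-β) (n + 1) :=
  summable_of_sum_range_le (fun n => neg_nonneg.2 (risingCoef_neg_nonpos hβ0.le hβ1.le n))
    (sum_neg_risingCoef_le hβ1)

theorem absSummable_risingSeries {β : ℝ} (hβ0 : 0 < β) (hβ1 : β < 1) :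
    AbsSummable (risingSeries (-β)) := by
  refine (summable_nat_add_iff 1).1 ((summable_risingCoef_neg hβ0 hβ1).congr fun n => ?_)
  rw [coeff_risingSeries, Complex.norm_real, Real.norm_eq_abs,
    abs_of_nonpos (risingCoef_neg_nonpos hβ0.le hβ1.le n)]

theorem absSummable_binSeries {β : ℝ} (hβ0 : 0 < β) (hβ1 : β < 1) :
    AbsSummable (binSeries β) := by
  refine (absSummable_risingSeries hβ0 hβ1).congr fun n => ?_
  rw [coeff_risingSeries, binSeries, PowerSeries.coeff_mk, risingCoef_eq, neg_neg]
  simp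

theorem evalAt_binSeries (s : ℝ) {x : ℝ} (hx0 : 0 ≤ x) (hx1 : x < 1) :
    evalAt (x : ℂ) (binSeries s) = (((1 + x) ^ s : ℝ) : ℂ) := by
  have h := (Real.one_add_rpow_hasFPowerSeriesOnBall_zero (a := s)).hasSum (y := x) (by
    rw [← ENNReal.ofReal_one, Metric.eball_ofReal]
    simpa [abs_of_nonneg hx0] using hx1)
  rw [zero_add] at h
  rw [← (Complex.hasSum_ofReal.2 h).tsum_eq, evalAt]
  refine tsum_congr fun n => ?_
  simp [binSeries, genBinom_eq_choose, binomialSeries, mul_comm]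

theorem AbsSummable.tendsto_evalAt_one {f : PowerSeries ℂ} (hf : AbsSummable f) :
    Tendsto (fun x : ℝ => evalAt (x : ℂ) f) (𝓝[<] 1) (𝓝 (evalAt 1 f)) := by
  have hcont : ContinuousOn (fun x : ℝ => evalAt (x : ℂ) f) (Set.Icc 0 1) := by
    refine hf.continuousOn_evalAt.comp Complex.continuous_ofReal.continuousOn fun x hx => ?_
    simpa [abs_of_nonneg hx.1] using hx.2
  have := hcont 1 (by simp)
  rw [← nhdsWithin_Ico_eq_nhdsLT (show (0 : ℝ) < 1 by norm_num)]
  simpa using this.mono_left (nhdsWithin_mono _ Set.Ico_subset_Icc_self)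

theorem evalAt_one_binSeries {β : ℝ} (hβ0 : 0 < β) (hβ1 : β < 1) :
    evalAt 1 (binSeries β) = ((2 ^ β : ℝ) : ℂ) := by
  have h2 : Tendsto (fun x : ℝ => (((1 + x) ^ β : ℝ) : ℂ)) (𝓝[<] 1) (𝓝 ((2 ^ β : ℝ) : ℂ)) := by
    have : ContinuousAt (fun x : ℝ => (((1 + x) ^ β : ℝ) : ℂ)) 1 := by
      refine Complex.continuous_ofReal.continuousAt.comp ?_
      exact (continuousAt_const.add continuousAt_id).rpow_const (Or.inl (by norm_num))
    have h3 := this.tendsto.mono_left (nhdsWithin_le_nhds (s := Set.Iio 1))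
    norm_num at h3 ⊢
    exact h3
  refine tendsto_nhds_unique
    ((absSummable_binSeries hβ0 hβ1).tendsto_evalAt_one.congr' ?_) h2
  filter_upwards [Ico_mem_nhdsLT (show (0 : ℝ) < 1 by norm_num)] with x hx
    using evalAt_binSeries β hx.1 hx.2

theorem genBinom_add_one_succ (s : ℝ) (n : ℕ) :
    genBinom (s + 1) (n + 1) = genBinom s n * ((s + 1) / (n + 1)) := by
  induction n with
  | zero => simp [genBinom]
  | succ n ih =>
    rw [genBinom_succ, ih, genBinom_succ]
    have h2 : (n : ℝ) + 1 ≠ 0 := by positivity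
    have h3 : (n : ℝ) + 1 + 1 ≠ 0 := by positivity
    push_cast
    field_simp
    ring

theorem summable_tsum_nat_add {b : ℕ → ℝ} (hb0 : ∀ n, 0 ≤ b n)
    (hb : Summable fun n : ℕ => ((n : ℝ) + 1) * b n) :
    Summable fun l => ∑' j, b (l + j) := by
  have hS : Summable fun p : ℕ × ℕ => b (p.1 + p.2) := by
    rw [← Finset.HasAntidiagonal.sigmaAntidiagonalEquivProd.summable_iff]
    refine (summable_sigma_of_nonneg fun _ => hb0 _).2 ⟨fun n => Summable.of_finite, ?_⟩
    refine hb.congr fun n => ?_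
    rw [tsum_fintype, Finset.sum_congr rfl fun p _ => ?_, Finset.sum_const (b n)]
    · simp
    · have := Finset.HasAntidiagonal.mem_antidiagonal.1 p.2
      simp only [Finset.HasAntidiagonal.sigmaAntidiagonalEquivProd_apply]
      rw [this]
  exact ((summable_prod_of_nonneg fun _ => hb0 _).1 hS).2

theorem exists_eq_C_add_one_sub_X_mul {f : PowerSeries ℂ} {w : ℕ → ℝ} (hw0 : ∀ n, 1 ≤ w n)
    (hw : Monotone w)
    (hf : Summable fun n : ℕ => ((n : ℝ) + 1) * (w n * ‖PowerSeries.coeff n f‖)) :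
    ∃ (a : ℂ) (g : PowerSeries ℂ), f = PowerSeries.C a + (1 - PowerSeries.X) * g ∧
      Summable fun n => w n * ‖PowerSeries.coeff n g‖ := by
  have hw1 : ∀ n, 0 ≤ w n := fun n => zero_le_one.trans (hw0 n)
  have hb0 : ∀ n, 0 ≤ w n * ‖PowerSeries.coeff n f‖ :=
    fun n => mul_nonneg (hw1 n) (norm_nonneg _)
  have hb : Summable fun n => w n * ‖PowerSeries.coeff n f‖ :=
    hf.of_nonneg_of_le hb0 fun n => le_mul_of_one_le_left (hb0 n) (by simp)
  have ha : Summable fun n => ‖PowerSeries.coeff n f‖ :=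
    hb.of_nonneg_of_le (fun n => norm_nonneg _) fun n =>
      le_mul_of_one_le_left (norm_nonneg _) (hw0 n)
  have hT : ∀ l, Summable fun j => PowerSeries.coeff (l + j) f := fun l => by
    simpa only [add_comm] using (summable_nat_add_iff l).2 ha.of_norm
  have hT0 : ∀ l, ∑' j, PowerSeries.coeff (l + j) f =
      PowerSeries.coeff l f + ∑' j, PowerSeries.coeff (l + 1 + j) f := fun l => by
    rw [(hT l).tsum_eq_zero_add]
    simp [add_assoc, add_comm 1]
  refine ⟨∑' j, PowerSeries.coeff (0 + j) f,
    -PowerSeries.mk fun l => ∑' j, PowerSeries.coeff (l + 1 + j) f, ?_, ?_⟩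
  · ext n
    rw [sub_mul, one_mul]
    cases n with
    | zero =>
      simp only [PowerSeries.coeff_zero_C, map_add, map_sub, PowerSeries.coeff_zero_X_mul,
        sub_zero, map_neg, PowerSeries.coeff_mk, hT0 0]
      ring
    | succ n => simp [PowerSeries.coeff_succ_X_mul, hT0 (n + 1)]
  · have := (summable_nat_add_iff 1).2 (summable_tsum_nat_add hb0 hf)
    refine this.of_nonneg_of_le (fun n => mul_nonneg (hw1 n) (norm_nonneg _)) fun n => ?_
    have hs : Summable fun j => ‖PowerSeries.coeff (n + 1 + j) f‖ := by
      simpa only [add_comm] using (summable_nat_add_iff (n + 1)).2 ha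
    have hs2 : Summable fun j => w (n + 1 + j) * ‖PowerSeries.coeff (n + 1 + j) f‖ := by
      simpa only [add_comm] using (summable_nat_add_iff (n + 1)).2 hb
    rw [map_neg, norm_neg, PowerSeries.coeff_mk]
    calc w n * ‖∑' j, PowerSeries.coeff (n + 1 + j) f‖
        ≤ w n * ∑' j, ‖PowerSeries.coeff (n + 1 + j) f‖ :=
          mul_le_mul_of_nonneg_left (norm_tsum_le_tsum_norm hs) (hw1 n)
      _ = ∑' j, w n * ‖PowerSeries.coeff (n + 1 + j) f‖ := tsum_mul_left.symm
      _ ≤ _ := (hs.mul_left _).tsum_le_tsum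
          (fun j => mul_le_mul_of_nonneg_right (hw (by omega)) (norm_nonneg _)) hs2

theorem exists_eq_add_sq_one_sub_X_mul {f : PowerSeries ℂ}
    (hf : Summable fun n : ℕ => ((n : ℝ) + 1) * (((n : ℝ) + 1) * ‖PowerSeries.coeff n f‖)) :
    ∃ (a b : ℂ) (g : PowerSeries ℂ), f = PowerSeries.C a + PowerSeries.C b * (1 - PowerSeries.X) +
      (1 - PowerSeries.X) ^ 2 * g ∧ AbsSummable g := by
  obtain ⟨a, g, h1, hg⟩ := exists_eq_C_add_one_sub_X_mul (w := fun n => (n : ℝ) + 1)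
    (fun n => by simp) (fun m n h => by simpa using h) hf
  obtain ⟨b, q, h2, hq⟩ := exists_eq_C_add_one_sub_X_mul (f := g) (w := fun _ => 1)
    (fun n => le_rfl) monotone_const (by simpa using hg)
  refine ⟨a, b, q, ?_, by simpa [AbsSummable] using hq⟩
  rw [h1, h2]
  ring

theorem exists_binSeries_add_two_eq {β : ℝ} (hβ0 : 0 < β) (hβ1 : β < 1) :
    ∃ (a b : ℂ) (g : PowerSeries ℂ), binSeries (β + 2) = PowerSeries.C a +
      PowerSeries.C b * (1 - PowerSeries.X) + (1 - PowerSeries.X) ^ 2 * g ∧ AbsSummable g := by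
  refine exists_eq_add_sq_one_sub_X_mul ((summable_nat_add_iff 2).1 ?_)
  refine ((absSummable_binSeries hβ0 hβ1).mul_left (5 * ((β + 2) * (β + 1)))).of_nonneg_of_le
    (fun n => by positivity) fun n => ?_
  have e : β + 2 = β + 1 + 1 := by ring
  rw [binSeries, binSeries, PowerSeries.coeff_mk, PowerSeries.coeff_mk, Complex.norm_real,
    Complex.norm_real, e, genBinom_add_one_succ, genBinom_add_one_succ, norm_mul, norm_mul,
    Real.norm_of_nonneg (by positivity : 0 ≤ (β + 1) / ((n : ℝ) + 1)),
    Real.norm_of_nonneg (by positivity : 0 ≤ (β + 1 + 1) / (((n + 1 : ℕ) : ℝ) + 1))]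
  push_cast
  have hn : (0 : ℝ) ≤ n := n.cast_nonneg
  have h : ((n : ℝ) + 2 + 1) * ((n : ℝ) + 2 + 1) ≤ 5 * ((n + 1) * (n + 1 + 1)) := by nlinarith
  have h0 : 0 ≤ ‖genBinom β n‖ * ((β + 1) * (β + 1 + 1)) / ((n + 1) * (n + 1 + 1)) := by
    positivity
  calc _ = (((n : ℝ) + 2 + 1) * ((n : ℝ) + 2 + 1)) *
        (‖genBinom β n‖ * ((β + 1) * (β + 1 + 1)) / ((n + 1) * (n + 1 + 1))) := by
        field_simp
    _ ≤ _ := mul_le_mul_of_nonneg_right h h0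
    _ = _ := by field_simp

/-- Second order expansion of `((1 + z) / 2) ^ β` at `z = 1`. -/
theorem exists_half_binSeries_eq {β : ℝ} (hβ0 : 0 < β) (hβ1 : β < 1) :
    ∃ Q : PowerSeries ℂ, AbsSummable Q ∧
      PowerSeries.C ((2 ^ (-β) : ℝ) : ℂ) * binSeries β =
        1 - PowerSeries.C ((β / 2 : ℝ) : ℂ) * (1 - PowerSeries.X) +
          (1 - PowerSeries.X) ^ 2 * Q := by
  obtain ⟨a, b, g, hP, hg⟩ := exists_binSeries_add_two_eq hβ0 hβ1
  have h2 : binSeries (β + 2) = (1 + PowerSeries.X) ^ 2 * binSeries β := by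
    rw [show β + 2 = β + 1 + 1 by ring, binSeries_add, binSeries_add, binSeries_one]
    ring
  obtain ⟨a', b', q, hq, hf⟩ : ∃ (a b : ℂ) (q : PowerSeries ℂ), AbsSummable q ∧
      PowerSeries.C ((2 ^ (-β) : ℝ) : ℂ) * binSeries β = PowerSeries.C a +
        PowerSeries.C b * (1 - PowerSeries.X) + (1 - PowerSeries.X) ^ 2 * q := by
    set c : ℂ := ((2 ^ (-β) : ℝ) : ℂ)
    have hC : (PowerSeries.C (1 / 4 : ℂ)) * 4 = 1 := by
      rw [show (4 : PowerSeries ℂ) = PowerSeries.C (4 : ℂ) from (map_ofNat _ 4).symm, ← map_mul]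
      norm_num
    have h3 : (1 : PowerSeries ℂ) * 4 =
        (1 + PowerSeries.X) ^ 2 * (2 - PowerSeries.X) +
          (1 - PowerSeries.X) ^ 2 * (2 + PowerSeries.X) := by
      ring
    have hX1 : AbsSummable (1 - PowerSeries.X) := AbsSummable.one_sub_X
    refine ⟨c * (1 / 4) * a, c * (1 / 4) * (a + b), PowerSeries.C (c * (1 / 4)) *
      (PowerSeries.C b + (2 - PowerSeries.X) * g + (2 + PowerSeries.X) * binSeries β), ?_, ?_⟩
    · have e1 : (2 - PowerSeries.X : PowerSeries ℂ) = 1 + (1 - PowerSeries.X) := by ring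
      have e2 : (2 + PowerSeries.X : PowerSeries ℂ) = 1 + 1 + 1 - (1 - PowerSeries.X) := by ring
      have e3 : PowerSeries.C b = PowerSeries.C b * 1 := (mul_one _).symm
      rw [e1, e2, e3]
      have h1 := AbsSummable.one
      exact (((h1.C_mul b).add ((h1.add hX1).mul hg)).add
        ((((h1.add h1).add h1).sub hX1).mul (absSummable_binSeries hβ0 hβ1))).C_mul _
    · have h4 : binSeries β * 4 = (2 - PowerSeries.X) * (PowerSeries.C a +
          PowerSeries.C b * (1 - PowerSeries.X) + (1 - PowerSeries.X) ^ 2 * g) +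
          (1 - PowerSeries.X) ^ 2 * ((2 + PowerSeries.X) * binSeries β) := by
        rw [← hP, h2]
        linear_combination (binSeries β) * h3
      simp only [map_mul, map_add]
      linear_combination (-(PowerSeries.C c * binSeries β)) * hC +
        PowerSeries.C c * PowerSeries.C (1 / 4) * h4
  have hX : ∀ z : ℂ, SummableAt z (1 - PowerSeries.X) := summableAt_one_sub_X
  have hev : ∀ z : ℂ, ‖z‖ ≤ 1 → evalAt z (PowerSeries.C ((2 ^ (-β) : ℝ) : ℂ) * binSeries β) =
      a' + b' * (1 - z) + (1 - z) ^ 2 * evalAt z q := by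
    intro z hz
    have hqz := hq.summableAt hz
    have ha : PowerSeries.C a' = PowerSeries.C a' * 1 := (mul_one _).symm
    rw [hf, ha, sq, evalAt_add (((summableAt_one z).C_mul _).add ((hX z).C_mul _))
      (((hX z).mul (hX z)).mul hqz), evalAt_add ((summableAt_one z).C_mul _) ((hX z).C_mul _),
      evalAt_mul ((hX z).mul (hX z)) hqz, evalAt_mul (hX z) (hX z), evalAt_C_mul, evalAt_C_mul,
      evalAt_one_sub_X, evalAt_one, mul_one, sq]
  have hpow : (2 : ℝ) ^ (-β) * 2 ^ β = 1 := by
    rw [← Real.rpow_add (by norm_num), neg_add_cancel, Real.rpow_zero]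
  have ha1 : a' = 1 := by
    have := hev 1 (by simp)
    rw [evalAt_C_mul, evalAt_one_binSeries hβ0 hβ1, ← Complex.ofReal_mul, hpow] at this
    simpa using this.symm
  have hb1 : b' = -((β / 2 : ℝ) : ℂ) := by
    have hd : HasDerivAt (fun x : ℝ => (((1 + x) / 2) ^ β : ℝ)) (β / 2) 1 := by
      have := ((((hasDerivAt_id (1 : ℝ)).const_add 1).div_const 2).rpow_const (p := β)
        (Or.inl (by norm_num)))
      norm_num at this
      convert this using 1
      ring
    have hs : Tendsto (fun x : ℝ => ((slope (fun x : ℝ => (((1 + x) / 2) ^ β : ℝ)) 1 x : ℝ) : ℂ))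
        (𝓝[<] 1) (𝓝 ((β / 2 : ℝ) : ℂ)) :=
      (Complex.continuous_ofReal.tendsto _).comp
        (hd.tendsto_slope.mono_left (nhdsWithin_mono _ fun x hx => ne_of_lt hx))
    have hl : Tendsto (fun x : ℝ => -b' - (1 - (x : ℂ)) * evalAt (x : ℂ) q) (𝓝[<] 1)
        (𝓝 (-b' - (1 - ((1 : ℝ) : ℂ)) * evalAt 1 q)) := by
      refine tendsto_const_nhds.sub (Tendsto.mul ?_ hq.tendsto_evalAt_one)
      exact (Continuous.tendsto (by fun_prop) (1 : ℝ)).mono_left nhdsWithin_le_nhds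
    have := tendsto_nhds_unique (hs.congr' ?_) hl
    · rw [this]
      simp
    filter_upwards [Ico_mem_nhdsLT (show (0 : ℝ) < 1 by norm_num)] with x hx
    have h5 := hev x (by simpa [abs_of_nonneg hx.1] using hx.2.le)
    rw [evalAt_C_mul, evalAt_binSeries β hx.1 hx.2, ← Complex.ofReal_mul, ha1] at h5
    have h6 : (2 : ℝ) ^ (-β) * (1 + x) ^ β = ((1 + x) / 2) ^ β := by
      rw [Real.div_rpow (by linarith [hx.1]) (by norm_num), Real.rpow_neg (by norm_num)]
      field_simp
    rw [h6] at h5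
    have h7 : (x : ℂ) - 1 ≠ 0 := by
      rw [← Complex.ofReal_one, ← Complex.ofReal_sub]
      exact_mod_cast (sub_neg.2 hx.2).ne
    rw [slope_def_field]
    push_cast at h5 ⊢
    rw [h5]
    field_simp
    norm_num
    ring
  refine ⟨q, hq, ?_⟩
  rw [hf, ha1, hb1, map_neg, map_one]
  ring

theorem isBigO_inv_add_natCast (a : ℝ) :
    (fun n : ℕ => (a + (n : ℝ))⁻¹) =O[atTop] fun n : ℕ => (n : ℝ)⁻¹ := by
  refine Asymptotics.IsBigO.of_bound 2 ?_
  filter_upwards [eventually_ge_atTop (⌈2 * |a|⌉₊ + 1)] with n hn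
  have h1 : 2 * |a| + 1 ≤ n := by
    have := Nat.le_ceil (2 * |a|)
    have h2 : ((⌈2 * |a|⌉₊ + 1 : ℕ) : ℝ) ≤ n := by exact_mod_cast hn
    push_cast at h2
    linarith
  have h2 := neg_abs_le a
  have h3 := abs_nonneg a
  rw [Real.norm_of_nonneg (inv_nonneg.2 (by linarith)), Real.norm_of_nonneg (by positivity),
    inv_le_comm₀ (by linarith) (mul_pos two_pos (inv_pos.2 (by linarith))), mul_inv, inv_inv]
  linarith

theorem isBigO_log_one_add :
    (fun x : ℝ => Real.log (1 + x) - x + x ^ 2 / 2) =O[𝓝 0] fun x => x ^ 3 := by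
  refine Asymptotics.IsBigO.of_bound 2 ?_
  filter_upwards [Metric.ball_mem_nhds (0 : ℝ) (show (0 : ℝ) < 1 / 2 by norm_num)] with x hx
  rw [mem_ball_zero_iff, Real.norm_eq_abs] at hx
  have h := Real.abs_log_sub_add_sum_range_le (x := -x) (by rw [abs_neg]; linarith) 2
  rw [abs_neg] at h
  norm_num [Finset.sum_range_succ] at h
  rw [Real.norm_eq_abs, norm_pow, Real.norm_eq_abs]
  calc |Real.log (1 + x) - x + x ^ 2 / 2| = |-x + x ^ 2 / 2 + Real.log (1 + x)| := by
        congr 1; ring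
    _ ≤ |x| ^ 3 / (1 - |x|) := h
    _ ≤ 2 * |x| ^ 3 := by
        rw [div_le_iff₀ (by linarith)]
        have : 0 ≤ |x| ^ 3 := by positivity
        nlinarith

theorem le_mul_inv_sq_of_tendsto_zero {v : ℕ → ℝ} (hv : Tendsto v atTop (𝓝 0)) {C : ℝ} {N : ℕ}
    (hN : 1 ≤ N) (hd : ∀ n ≥ N, -(C * ((n : ℝ)⁻¹) ^ 3) ≤ v (n + 1) - v n) (hC : 0 ≤ C) :
    ∀ n ≥ N, v n ≤ 2 * C * ((n : ℝ)⁻¹) ^ 2 := by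
  have hm : Monotone fun k : ℕ => v (k + N) - 2 * C * (((k + N : ℕ) : ℝ)⁻¹) ^ 2 := by
    refine monotone_nat_of_le_succ fun k => ?_
    have h := hd (k + N) (by omega)
    rw [show k + 1 + N = k + N + 1 by ring]
    have hx : (1 : ℝ) ≤ ((k + N : ℕ) : ℝ) := by exact_mod_cast (by omega : 1 ≤ k + N)
    rw [Nat.cast_succ]
    generalize ((k + N : ℕ) : ℝ) = x at *
    have h2 : (x⁻¹) ^ 3 ≤ 2 * (x⁻¹) ^ 2 - 2 * ((x + 1)⁻¹) ^ 2 := by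
      have e : 2 * (x⁻¹) ^ 2 - 2 * ((x + 1)⁻¹) ^ 2 - (x⁻¹) ^ 3 =
          (3 * x ^ 2 - 1) / (x ^ 3 * (x + 1) ^ 2) := by
        have : x + 1 ≠ 0 := by positivity
        field_simp
        ring
      have : 0 ≤ (3 * x ^ 2 - 1) / (x ^ 3 * (x + 1) ^ 2) :=
        div_nonneg (by nlinarith) (by positivity)
      linarith
    nlinarith [mul_le_mul_of_nonneg_left h2 hC]
  have ht : Tendsto (fun k : ℕ => v (k + N) - 2 * C * (((k + N : ℕ) : ℝ)⁻¹) ^ 2) atTop (𝓝 0) := by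
    have h1 : Tendsto (fun n : ℕ => v n - 2 * C * ((n : ℝ)⁻¹) ^ 2) atTop (𝓝 0) := by
      simpa using hv.sub
        (((tendsto_natCast_atTop_atTop (R := ℝ)).inv_tendsto_atTop.pow 2).const_mul (2 * C))
    exact h1.comp (tendsto_add_atTop_nat N)
  intro n hn
  have := hm.ge_of_tendsto ht (n - N)
  simp only [Nat.sub_add_cancel hn] at this
  linarith

theorem isBigO_inv_sq_of_tendsto_zero {v : ℕ → ℝ} (hv : Tendsto v atTop (𝓝 0))
    (hd : (fun n => v (n + 1) - v n) =O[atTop] fun n : ℕ => ((n : ℝ)⁻¹) ^ 3) :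
    v =O[atTop] fun n : ℕ => ((n : ℝ)⁻¹) ^ 2 := by
  obtain ⟨C, hC, hb⟩ := hd.exists_pos
  obtain ⟨N, hN⟩ := eventually_atTop.1 hb.bound
  have key : ∀ n ≥ max N 1, |v (n + 1) - v n| ≤ C * ((n : ℝ)⁻¹) ^ 3 := fun n hn => by
    have := hN n (le_of_max_le_left hn)
    rwa [Real.norm_eq_abs, Real.norm_of_nonneg (by positivity)] at this
  refine Asymptotics.IsBigO.of_bound (2 * C) ?_
  filter_upwards [eventually_ge_atTop (max N 1)] with n hn
  rw [Real.norm_of_nonneg (by positivity : (0 : ℝ) ≤ ((n : ℝ)⁻¹) ^ 2), Real.norm_eq_abs, abs_le]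
  constructor
  · have := le_mul_inv_sq_of_tendsto_zero (v := fun n => -v n) (by simpa using hv.neg)
      (le_max_right N 1) (fun m hm => by have := (abs_le.1 (key m hm)).2; linarith) hC.le n hn
    linarith
  · exact le_mul_inv_sq_of_tendsto_zero hv
      (le_max_right N 1) (fun m hm => by have := (abs_le.1 (key m hm)).1; linarith) hC.le n hn

theorem tendsto_Gamma_mul_risingCoef_div {s : ℝ} (hs : -1 < s) :
    Tendsto (fun n : ℕ => Real.Gamma (s + 1) * risingCoef (s + 1) n / (n : ℝ) ^ s)
      atTop (𝓝 1) := by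
  have hG : Real.Gamma (s + 1) ≠ 0 := (Real.Gamma_pos_of_pos (by linarith)).ne'
  have h1 := ((Real.GammaSeq_tendsto_Gamma (s + 1)).inv₀ hG).const_mul (Real.Gamma (s + 1))
  rw [mul_inv_cancel₀ hG] at h1
  have h2 : Tendsto (fun n : ℕ => (n : ℝ) / (n + (s + 1))) atTop (𝓝 1) :=
    tendsto_natCast_div_add_atTop (s + 1)
  have := h1.mul h2
  rw [mul_one] at this
  refine this.congr' ?_
  filter_upwards [eventually_gt_atTop 0] with n hn
  have hn' : (0 : ℝ) < n := by exact_mod_cast hn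
  have hf : (Nat.factorial n : ℝ) ≠ 0 := by positivity
  have hns : (n : ℝ) + (s + 1) ≠ 0 := by linarith
  have hp : (n : ℝ) ^ s ≠ 0 := (Real.rpow_pos_of_pos hn' s).ne'
  rw [Real.GammaSeq, Finset.prod_range_succ, risingCoef, Real.rpow_add_one hn'.ne',
    add_comm _ (n : ℝ)]
  have hpr : ∏ j ∈ Finset.range n, (s + 1 + (j : ℝ)) ≠ 0 :=
    (Finset.prod_pos fun j _ => by linarith [(j.cast_nonneg : (0 : ℝ) ≤ j)]).ne'
  field_simp

/-- Second order asymptotics of the coefficients of `(1 - z) ^ (-(s + 1))`. -/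
theorem isBigO_rpow_sub_risingCoef {s : ℝ} (hs : -1 < s) :
    (fun n : ℕ => (n : ℝ) ^ s -
      Real.Gamma (s + 1) * (risingCoef (s + 1) n - (s + 1) / 2 * risingCoef s n))
      =O[atTop] fun n : ℕ => (n : ℝ) ^ (s - 2) := by
  set κ : ℝ := s * (s + 1) / 2 with hκ
  have hG : 0 < Real.Gamma (s + 1) := Real.Gamma_pos_of_pos (by linarith)
  have hR : ∀ n, 0 < risingCoef (s + 1) n := risingCoef_pos (by linarith)
  set w : ℕ → ℝ := fun n => Real.log (Real.Gamma (s + 1) * risingCoef (s + 1) n / (n : ℝ) ^ s)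
    with hw
  set L : ℕ → ℝ := fun n => (n : ℝ)⁻¹ with hL
  have hL0 : Tendsto L atTop (𝓝 0) := (tendsto_natCast_atTop_atTop (R := ℝ)).inv_tendsto_atTop
  have hw0 : Tendsto w atTop (𝓝 0) := by
    simpa using (tendsto_Gamma_mul_risingCoef_div hs).log one_ne_zero
  have hlog : ∀ a : ℝ, (fun n : ℕ => Real.log (1 + a * (1 + (n : ℝ))⁻¹) - a * (1 + (n : ℝ))⁻¹ +
      (a * (1 + (n : ℝ))⁻¹) ^ 2 / 2) =O[atTop] fun n => L n ^ 3 := fun a => by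
    have h1 := (isBigO_inv_add_natCast 1).const_mul_left a
    exact (isBigO_log_one_add.comp_tendsto (h1.trans_tendsto hL0)).trans (h1.pow 3)
  have hv : (fun n => w n - κ * L n) =O[atTop] fun n => L n ^ 2 := by
    refine isBigO_inv_sq_of_tendsto_zero (by simpa using hw0.sub (hL0.const_mul κ)) ?_
    have h3 : (fun n : ℕ => κ * (L n * ((1 + (n : ℝ))⁻¹) ^ 2)) =O[atTop] fun n => L n ^ 3 := by
      refine (((Asymptotics.isBigO_refl L atTop).mul
        ((isBigO_inv_add_natCast 1).pow 2)).const_mul_left κ).congr_right fun n => ?_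
      ring
    refine (((hlog s).add ((hlog (-1)).const_mul_left s)).add h3).congr' ?_ EventuallyEq.rfl
    filter_upwards [eventually_gt_atTop 0] with n hn
    have hn' : (0 : ℝ) < n := by exact_mod_cast hn
    have hn1 : (0 : ℝ) < 1 + n := by positivity
    have e1 : w (n + 1) - w n =
        Real.log (1 + s * (1 + (n : ℝ))⁻¹) + s * Real.log (1 + -1 * (1 + (n : ℝ))⁻¹) := by
      have f1 : 1 + s * (1 + (n : ℝ))⁻¹ = (s + 1 + n) / (n + 1) := by
        field_simp
        ring
      have f2 : 1 + -1 * (1 + (n : ℝ))⁻¹ = n / (n + 1) := by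
        field_simp
        ring
      have hsn : 0 < s + 1 + n := by linarith
      simp only [hw]
      rw [f1, f2, risingCoef_succ, Real.log_div (mul_pos hG (mul_pos (hR n) (by positivity))).ne'
        (by positivity), Real.log_div (mul_pos hG (hR n)).ne' (by positivity),
        Real.log_mul hG.ne' (mul_pos (hR n) (by positivity)).ne',
        Real.log_mul (hR n).ne' (by positivity), Real.log_mul hG.ne' (hR n).ne',
        Real.log_rpow (by positivity), Real.log_rpow hn', Real.log_div hn'.ne' (by positivity)]
      push_cast
      ring
    have e2 : L (n + 1) = (1 + (n : ℝ))⁻¹ := by simp [hL, add_comm]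
    rw [e2, show w (n + 1) - κ * (1 + (n : ℝ))⁻¹ - (w n - κ * L n) =
      w (n + 1) - w n - κ * (1 + (n : ℝ))⁻¹ + κ * L n by ring, e1, hκ]
    simp only [hL]
    field_simp
    ring
  have hw1 : w =O[atTop] L := by
    have h2 : (fun n => L n ^ 2) =O[atTop] L := by
      have : (fun n => L n * L n) =O[atTop] fun n => (1 : ℝ) * L n :=
        (hL0.isBigO_one ℝ).mul (Asymptotics.isBigO_refl L atTop)
      simpa [sq] using this
    have := (hv.trans h2).add ((Asymptotics.isBigO_refl L atTop).const_mul_left κ)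
    simpa using this
  have hexp : (fun n => Real.exp (w n) - 1 - κ * L n) =O[atTop] fun n => L n ^ 2 := by
    have h1 : (fun n => Real.exp (w n) - 1 - w n) =O[atTop] fun n => L n ^ 2 := by
      refine Asymptotics.IsBigO.trans ?_ (hw1.pow 2)
      refine Asymptotics.IsBigO.of_bound 1 ?_
      filter_upwards [hw0.eventually (Metric.ball_mem_nhds (0 : ℝ) one_pos)] with n hn
      rw [dist_zero_right] at hn
      rw [one_mul, Real.norm_eq_abs, Real.norm_of_nonneg (sq_nonneg _)]
      exact Real.abs_exp_sub_one_sub_id_le hn.le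
    exact (h1.add hv).congr_left fun n => by ring
  have hI := isBigO_inv_add_natCast s
  have hmain : (fun n : ℕ => 1 - Real.exp (w n) * (1 - κ * (s + (n : ℝ))⁻¹)) =O[atTop]
      fun n => L n ^ 2 := by
    have hb : (fun n : ℕ => 1 - κ * (s + (n : ℝ))⁻¹) =O[atTop] fun _ => (1 : ℝ) :=
      (tendsto_const_nhds.sub ((hI.trans_tendsto hL0).const_mul κ)).isBigO_one ℝ
    have h1 := (hexp.mul hb).congr_right fun n => mul_one _
    have h2 : (fun n : ℕ => (κ ^ 2 - κ * s) * (L n * (s + (n : ℝ))⁻¹)) =O[atTop]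
        fun n => L n ^ 2 := by
      refine (((Asymptotics.isBigO_refl L atTop).mul hI).const_mul_left _).congr_right fun n => ?_
      ring
    refine (h2.sub h1).congr' ?_ EventuallyEq.rfl
    filter_upwards [eventually_gt_atTop 0] with n hn
    have hn' : (1 : ℝ) ≤ n := by exact_mod_cast hn
    have hsn : s + n ≠ 0 := by linarith
    simp only [hL]
    field_simp
    ring
  refine ((Asymptotics.isBigO_refl (fun n : ℕ => (n : ℝ) ^ s) atTop).mul hmain).congr' ?_ ?_
  · filter_upwards [eventually_gt_atTop 0] with n hn
    have hn' : (1 : ℝ) ≤ n := by exact_mod_cast hn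
    have hsn : s + n ≠ 0 := by linarith
    have hp : 0 < (n : ℝ) ^ s := Real.rpow_pos_of_pos (by linarith) s
    have e : risingCoef s n = s * risingCoef (s + 1) n * (s + n)⁻¹ := by
      rw [← add_mul_risingCoef]
      field_simp
    simp only [hw]
    rw [Real.exp_log (div_pos (mul_pos hG (hR n)) hp), e, hκ]
    field_simp
  · filter_upwards [eventually_gt_atTop 0] with n hn
    have hn' : (0 : ℝ) < n := by exact_mod_cast hn
    rw [Real.rpow_sub hn']
    simp [hL, div_eq_mul_inv]

theorem BddCoeff.of_isBigO {f : PowerSeries ℂ}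
    (hf : (fun n => PowerSeries.coeff n f) =O[atTop] fun _ => (1 : ℝ)) : BddCoeff f := by
  obtain ⟨C, -, hC⟩ := Asymptotics.bound_of_isBigO_nat_atTop hf
  exact ⟨C, fun n => by simpa using hC (x := n) one_ne_zero⟩

theorem isBigO_rpow_rpow_of_le {s t : ℝ} (h : s ≤ t) :
    (fun n : ℕ => (n : ℝ) ^ s) =O[atTop] fun n : ℕ => (n : ℝ) ^ t := by
  refine Asymptotics.IsBigO.of_bound 1 ?_
  filter_upwards [eventually_ge_atTop 1] with n hn
  rw [one_mul, Real.norm_of_nonneg (by positivity), Real.norm_of_nonneg (by positivity)]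
  exact Real.rpow_le_rpow_of_exponent_le (by exact_mod_cast hn) h

/-- The generating function of the sequence `n ^ s`. -/
noncomputable def powSeries (s : ℝ) : PowerSeries ℂ :=
  PowerSeries.mk fun n => (((n : ℝ) ^ s : ℝ) : ℂ)

/-- The error of the two-term expansion of `powSeries s` in powers of `1 - X`. -/
noncomputable def powRemainder (s : ℝ) : PowerSeries ℂ :=
  powSeries s - PowerSeries.C ((Real.Gamma (s + 1) : ℝ) : ℂ) *
    (risingSeries (s + 1) - PowerSeries.C (((s + 1) / 2 : ℝ) : ℂ) * risingSeries s)

theorem powSeries_eq (s : ℝ) : powSeries s = PowerSeries.C ((Real.Gamma (s + 1) : ℝ) : ℂ) *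
    (risingSeries (s + 1) - PowerSeries.C (((s + 1) / 2 : ℝ) : ℂ) * risingSeries s) +
      powRemainder s := by
  rw [powRemainder]
  ring

theorem isBigO_coeff_powRemainder {s : ℝ} (hs : -1 < s) :
    (fun n => PowerSeries.coeff n (powRemainder s)) =O[atTop] fun n : ℕ => (n : ℝ) ^ (s - 2) := by
  refine Asymptotics.IsBigO.congr_left (f₁ := fun n : ℕ => (((n : ℝ) ^ s -
      Real.Gamma (s + 1) * (risingCoef (s + 1) n - (s + 1) / 2 * risingCoef s n) : ℝ) : ℂ))
    ?_ fun n => ?_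
  · rw [← Asymptotics.isBigO_norm_left]
    simpa only [Complex.norm_real] using (isBigO_rpow_sub_risingCoef hs).norm_left
  · simp only [powRemainder, powSeries, map_sub, PowerSeries.coeff_C_mul, coeff_risingSeries,
      PowerSeries.coeff_mk]
    push_cast
    ring

theorem bddCoeff_powRemainder {s : ℝ} (hs : -1 < s) (hs2 : s ≤ 2) :
    BddCoeff (powRemainder s) := by
  refine BddCoeff.of_isBigO ((isBigO_coeff_powRemainder hs).trans ?_)
  simpa using isBigO_rpow_rpow_of_le (show s - 2 ≤ 0 by linarith)

theorem isBigO_rpow_neg_risingCoef {β : ℝ} (hβ1 : β < 1) :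
    (fun n : ℕ => (n : ℝ) ^ (-β)) =O[atTop] fun n => risingCoef (1 - β) n := by
  have h := tendsto_Gamma_mul_risingCoef_div (s := -β) (by linarith)
  refine Asymptotics.IsBigO.of_bound (2 * Real.Gamma (-β + 1)) ?_
  filter_upwards [h.eventually (lt_mem_nhds (show (1 / 2 : ℝ) < 1 by norm_num)),
    eventually_ge_atTop 1] with n hn hn1
  have hn' : (0 : ℝ) < n := by exact_mod_cast hn1
  rw [lt_div_iff₀ (by positivity), neg_add_eq_sub] at hn
  rw [Real.norm_of_nonneg (by positivity),
    Real.norm_of_nonneg (risingCoef_pos (by linarith) n).le, neg_add_eq_sub]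
  linarith

theorem tendsto_risingCoef_zero {β : ℝ} (hβ0 : 0 < β) (hβ1 : β < 1) :
    Tendsto (risingCoef (-β + 1)) atTop (𝓝 0) := by
  have hG : Real.Gamma (-β + 1) ≠ 0 := (Real.Gamma_pos_of_pos (by linarith)).ne'
  have h1 := tendsto_Gamma_mul_risingCoef_div (s := -β) (by linarith)
  have h2 : Tendsto (fun n : ℕ => (n : ℝ) ^ (-β)) atTop (𝓝 0) :=
    (tendsto_rpow_neg_atTop hβ0).comp tendsto_natCast_atTop_atTop
  have h3 := (h1.mul h2).const_mul (Real.Gamma (-β + 1))⁻¹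
  rw [mul_zero, mul_zero] at h3
  refine h3.congr' ?_
  filter_upwards [eventually_gt_atTop 0] with n hn
  have hp : (n : ℝ) ^ (-β) ≠ 0 := (Real.rpow_pos_of_pos (by exact_mod_cast hn) _).ne'
  field_simp

theorem exists_norm_coeff_powRemainder_le {β s : ℝ} (hβ1 : β < 1) (hs : -1 < s)
    (hs2 : s ≤ 2 - β) :
    ∃ C : ℝ, ∀ n, ‖PowerSeries.coeff n (powRemainder s)‖ ≤ C * risingCoef (1 - β) n := by
  obtain ⟨C, -, hC⟩ := Asymptotics.bound_of_isBigO_nat_atTop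
    (((isBigO_coeff_powRemainder hs).trans
      (isBigO_rpow_rpow_of_le (show s - 2 ≤ -β by linarith))).trans
        (isBigO_rpow_neg_risingCoef hβ1))
  refine ⟨C, fun n => ?_⟩
  have hp := risingCoef_pos (show 0 < 1 - β by linarith) n
  have := hC (x := n) hp.ne'
  rwa [Real.norm_of_nonneg hp.le] at this

theorem bddCoeff_risingSeries_mul {β : ℝ} (hβ0 : 0 < β) {f : PowerSeries ℂ} {C : ℝ}
    (hf : ∀ n, ‖PowerSeries.coeff n f‖ ≤ C * risingCoef (1 - β) n) :
    BddCoeff (risingSeries β * f) := by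
  have hC : 0 ≤ C := by
    have := (norm_nonneg _).trans (hf 0)
    rwa [risingCoef_zero, mul_one] at this
  refine ⟨C, fun n => ?_⟩
  have h1 : ∑ p ∈ Finset.HasAntidiagonal.antidiagonal n,
      risingCoef β p.1 * risingCoef (1 - β) p.2 = risingCoef 1 n := by
    have := congrArg (PowerSeries.coeff n) (risingSeries_add β (1 - β))
    rw [PowerSeries.coeff_mul, add_sub_cancel] at this
    simp only [coeff_risingSeries] at this
    exact_mod_cast this.symm
  rw [PowerSeries.coeff_mul]
  calc _ ≤ ∑ p ∈ Finset.HasAntidiagonal.antidiagonal n,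
        C * (risingCoef β p.1 * risingCoef (1 - β) p.2) := by
        refine norm_sum_le_of_le _ fun p _ => ?_
        have hp := (risingCoef_pos hβ0 p.1).le
        rw [norm_mul, coeff_risingSeries, Complex.norm_real, Real.norm_of_nonneg hp]
        nlinarith [mul_le_mul_of_nonneg_left (hf p.2) hp]
    _ = C * risingCoef 1 n := by rw [← Finset.mul_sum, h1]
    _ ≤ C * 1 := mul_le_mul_of_nonneg_left
        ((le_abs_self _).trans (abs_risingCoef_le_one (by norm_num) le_rfl n)) hC
    _ = C := mul_one C

theorem bddCoeff_risingSeries_of_le_one {s : ℝ} (hs : -2 ≤ s) (hs1 : s ≤ 1) :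
    BddCoeff (risingSeries s) := by
  rcases le_total (-1) s with h | h
  · exact bddCoeff_risingSeries h hs1
  · rw [← add_sub_cancel_right s 1, risingSeries_sub_one]
    exact BddCoeff.mul_left AbsSummable.one_sub_X
      (bddCoeff_risingSeries (by linarith) (by linarith))

/-- The generating function of the sequence `omegaCoef β`. -/
noncomputable def omegaSeries (β : ℝ) : PowerSeries ℂ :=
  PowerSeries.mk fun n => (omegaCoef β n : ℂ)

theorem omegaSeries_eq {β : ℝ} (hβ0 : 0 < β) : omegaSeries β =
    PowerSeries.C ((2 ^ (-β) : ℝ) : ℂ) * binSeries β * risingSeries β := by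
  ext n
  rw [mul_assoc, PowerSeries.coeff_C_mul, PowerSeries.coeff_mul,
    Finset.Nat.sum_antidiagonal_eq_sum_range_succ_mk, omegaSeries, PowerSeries.coeff_mk, omegaCoef]
  simp only [binSeries, PowerSeries.coeff_mk, coeff_risingSeries, risingCoef_eq_Gamma hβ0]
  push_cast
  simp only [mul_div_assoc]

theorem bddCoeff_half_binSeries_mul_sub {β s : ℝ} (hβ0 : 0 < β) (hβ1 : β < 1) (hs : 0 ≤ s)
    (hs3 : s ≤ 3) :
    BddCoeff (PowerSeries.C ((2 ^ (-β) : ℝ) : ℂ) * binSeries β * risingSeries s -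
      (risingSeries s - PowerSeries.C ((β / 2 : ℝ) : ℂ) * risingSeries (s - 1))) := by
  obtain ⟨Q, hQ, h⟩ := exists_half_binSeries_eq hβ0 hβ1
  have h2 : risingSeries (s - 2) = (1 - PowerSeries.X) ^ 2 * risingSeries s := by
    rw [show s - 2 = s - 1 - 1 by ring, risingSeries_sub_one, risingSeries_sub_one]
    ring
  have e := BddCoeff.mul_left hQ
    (bddCoeff_risingSeries_of_le_one (s := s - 2) (by linarith) (by linarith))
  rw [h2] at e
  rw [h, risingSeries_sub_one]
  convert e using 1
  ring

theorem bddCoeff_quadrature_error {β s : ℝ} (hβ0 : 0 < β) (hβ1 : β < 1) (hs : 0 ≤ s)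
    (hs2 : s ≤ 2 - β) :
    BddCoeff (PowerSeries.C ((Real.Gamma (s + 1) / Real.Gamma (s + 1 + β) : ℝ) : ℂ) *
      powSeries (s + β) - powSeries s * omegaSeries β) := by
  obtain ⟨C, hC⟩ := exists_norm_coeff_powRemainder_le hβ1 (by linarith) hs2
  have hA := (absSummable_binSeries hβ0 hβ1).C_mul ((2 ^ (-β) : ℝ) : ℂ)
  have b1 := bddCoeff_half_binSeries_mul_sub (s := s + β + 1) hβ0 hβ1 (by linarith) (by linarith)
  have b2 := bddCoeff_half_binSeries_mul_sub (s := s + β) hβ0 hβ1 (by linarith) (by linarith)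
  have b3 := bddCoeff_risingSeries_of_le_one (s := s + β - 1) (by linarith) (by linarith)
  have b4 := BddCoeff.mul_left hA (bddCoeff_risingSeries_mul hβ0 hC)
  have b5 := bddCoeff_powRemainder (s := s + β) (by linarith) (by linarith)
  have hG : Real.Gamma (s + 1) / Real.Gamma (s + 1 + β) * Real.Gamma (s + β + 1) =
      Real.Gamma (s + 1) := by
    rw [show s + β + 1 = s + 1 + β by ring]
    exact div_mul_cancel₀ _ (Real.Gamma_pos_of_pos (by linarith)).ne'
  have hG' : PowerSeries.C ((Real.Gamma (s + 1) / Real.Gamma (s + 1 + β) : ℝ) : ℂ) *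
      PowerSeries.C ((Real.Gamma (s + β + 1) : ℝ) : ℂ) =
      PowerSeries.C ((Real.Gamma (s + 1) : ℝ) : ℂ) := by
    rw [← map_mul, ← Complex.ofReal_mul, hG]
  have hc : PowerSeries.C (((s + β + 1) / 2 : ℝ) : ℂ) =
      PowerSeries.C ((β / 2 : ℝ) : ℂ) + PowerSeries.C (((s + 1) / 2 : ℝ) : ℂ) := by
    rw [← map_add, ← Complex.ofReal_add]
    ring_nf
  rw [add_sub_cancel_right] at b1
  have key := ((b5.C_mul ((Real.Gamma (s + 1) / Real.Gamma (s + 1 + β) : ℝ) : ℂ)).sub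
    ((b1.sub ((b2.sub (b3.C_mul ((β / 2 : ℝ) : ℂ))).C_mul (((s + 1) / 2 : ℝ) : ℂ))).C_mul
      ((Real.Gamma (s + 1) : ℝ) : ℂ))).sub b4
  have e1 : risingSeries (s + β + 1) = risingSeries (s + 1) * risingSeries β := by
    rw [← risingSeries_add]
    ring_nf
  have e2 : risingSeries (s + β) = risingSeries s * risingSeries β := risingSeries_add s β
  convert key using 1
  rw [powSeries_eq s, powSeries_eq (s + β), omegaSeries_eq hβ0, hc, e1, e2]
  linear_combination (risingSeries (s + 1) * risingSeries β -
    (PowerSeries.C ((β / 2 : ℝ) : ℂ) + PowerSeries.C (((s + 1) / 2 : ℝ) : ℂ)) *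
      (risingSeries s * risingSeries β)) * hG'

/-- The right-hand sides of the starting-weight systems are bounded in `n`. -/
theorem exists_abs_quadrature_error_le {β s : ℝ} (hβ0 : 0 < β) (hβ1 : β < 1) (hs : 0 ≤ s)
    (hs2 : s ≤ 2 - β) :
    ∃ C : ℝ, ∀ n : ℕ, |Real.Gamma (s + 1) / Real.Gamma (s + 1 + β) * (n : ℝ) ^ (s + β) -
      ∑ j ∈ Finset.range (n + 1), omegaCoef β (n - j) * (j : ℝ) ^ s| ≤ C := by
  obtain ⟨C, hC⟩ := bddCoeff_quadrature_error hβ0 hβ1 hs hs2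
  refine ⟨C, fun n => ?_⟩
  have := hC n
  rw [map_sub, PowerSeries.coeff_C_mul, PowerSeries.coeff_mul,
    Finset.Nat.sum_antidiagonal_eq_sum_range_succ_mk] at this
  simp only [powSeries, omegaSeries, PowerSeries.coeff_mk] at this
  rw [← Real.norm_eq_abs, ← Complex.norm_real]
  push_cast at this ⊢
  simpa only [mul_comm] using this

theorem coeff_sq_one_sub_X_mul (f : PowerSeries ℂ) (n : ℕ) (hn : 2 ≤ n) :
    PowerSeries.coeff n ((1 - PowerSeries.X) ^ 2 * f) = PowerSeries.coeff n f -
      2 * PowerSeries.coeff (n - 1) f + PowerSeries.coeff (n - 2) f := by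
  obtain ⟨n, rfl⟩ := Nat.exists_eq_add_of_le' hn
  have : (1 - PowerSeries.X) ^ 2 * f =
      f - PowerSeries.X * f - PowerSeries.X * (f - PowerSeries.X * f) := by ring
  rw [this]
  simp only [map_sub, PowerSeries.coeff_succ_X_mul]
  simp only [show n + 2 - 1 = n + 1 by omega, Nat.add_sub_cancel]
  ring

theorem bddCoeff_sq_one_sub_X_mul_powSeries {s : ℝ} (hs : 0 ≤ s) (hs2 : s ≤ 2) :
    BddCoeff ((1 - PowerSeries.X) ^ 2 * powSeries s) := by
  have h2 : ∀ t : ℝ, risingSeries (t - 2) = (1 - PowerSeries.X) ^ 2 * risingSeries t := by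
    intro t
    rw [show t - 2 = t - 1 - 1 by ring, risingSeries_sub_one, risingSeries_sub_one]
    ring
  have b1 := bddCoeff_risingSeries_of_le_one (s := s + 1 - 2) (by linarith) (by linarith)
  have b2 := bddCoeff_risingSeries_of_le_one (s := s - 2) (by linarith) (by linarith)
  have b3 := BddCoeff.mul_left (AbsSummable.one_sub_X.mul AbsSummable.one_sub_X)
    (bddCoeff_powRemainder (by linarith) hs2)
  have key := ((b1.sub (b2.C_mul (((s + 1) / 2 : ℝ) : ℂ))).C_mul
    ((Real.Gamma (s + 1) : ℝ) : ℂ)).add b3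
  convert key using 1
  rw [powSeries_eq, h2, h2]
  ring

/-- The right-hand sides of the extrapolation-weight systems are bounded in `n`. -/
theorem exists_abs_second_difference_rpow_le {s : ℝ} (hs : 0 ≤ s) (hs2 : s ≤ 2) :
    ∃ C : ℝ, ∀ n : ℕ, 2 ≤ n →
      |(n : ℝ) ^ s - 2 * ((n : ℝ) - 1) ^ s + ((n : ℝ) - 2) ^ s| ≤ C := by
  obtain ⟨C, hC⟩ := bddCoeff_sq_one_sub_X_mul_powSeries hs hs2
  refine ⟨C, fun n hn => ?_⟩
  have := hC n
  rw [coeff_sq_one_sub_X_mul _ _ hn] at this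
  simp only [powSeries, PowerSeries.coeff_mk, Nat.cast_sub hn, Nat.cast_sub (one_le_two.trans hn),
    Nat.cast_one, Nat.cast_ofNat] at this
  rw [← Real.norm_eq_abs, ← Complex.norm_real]
  push_cast at this ⊢
  exact this

/-- A sum of `n` real powers with distinct exponents and `n` positive zeros is trivial. -/
theorem eq_zero_of_sum_rpow_eq_zero {ι : Type*} [DecidableEq ι] (n : ℕ) :
    ∀ (S : Finset ι) (e c : ι → ℝ) (x : ℕ → ℝ), S.card = n → Set.InjOn e S → StrictMono x →
      (∀ i, 0 < x i) → (∀ i < n, ∑ a ∈ S, c a * x i ^ e a = 0) → ∀ a ∈ S, c a = 0 := by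
  induction n with
  | zero =>
    intro S e c x hS _ _ _ _ a ha
    rw [Finset.card_eq_zero.1 hS] at ha
    exact absurd ha (Finset.notMem_empty a)
  | succ n ih =>
    intro S e c x hS he hx hx0 hf
    obtain ⟨a₀, ha₀⟩ : S.Nonempty := Finset.card_pos.1 (by omega)
    set g : ℝ → ℝ := fun t => ∑ a ∈ S, c a * t ^ (e a - e a₀) with hg
    set g' : ℝ → ℝ := fun t => ∑ a ∈ S, c a * ((e a - e a₀) * t ^ (e a - e a₀ - 1)) with hg'
    have hd : ∀ t, 0 < t → HasDerivAt g (g' t) t := fun t ht =>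
      HasDerivAt.fun_sum fun a _ => (Real.hasDerivAt_rpow_const (Or.inl ht.ne')).const_mul (c a)
    have hg0 : ∀ i < n + 1, g (x i) = 0 := fun i hi => by
      have : g (x i) = (∑ a ∈ S, c a * x i ^ e a) / x i ^ e a₀ := by
        rw [Finset.sum_div]
        exact Finset.sum_congr rfl fun a _ => by rw [Real.rpow_sub (hx0 i), mul_div_assoc]
      rw [this, hf i hi, zero_div]
    have hy : ∀ i, ∃ y ∈ Set.Ioo (x i) (x (i + 1)), i < n → g' y = 0 := fun i => by
      by_cases hi : i < n
      · obtain ⟨y, hy, hy0⟩ := exists_hasDerivAt_eq_zero (f := g) (f' := g')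
          (hx (Nat.lt_succ_self i))
          (fun t ht => (hd t ((hx0 i).trans_le ht.1)).continuousAt.continuousWithinAt)
          (by rw [hg0 i (by omega), hg0 (i + 1) (by omega)])
          (fun t ht => hd t ((hx0 i).trans ht.1))
        exact ⟨y, hy, fun _ => hy0⟩
      · obtain ⟨y, hy⟩ := exists_between (hx (Nat.lt_succ_self i))
        exact ⟨y, hy, fun h => absurd h hi⟩
    choose y hyI hy0 using hy
    have hz := ih (S.erase a₀) (fun a => e a - e a₀ - 1) (fun a => c a * (e a - e a₀)) y
      (by rw [Finset.card_erase_of_mem ha₀, hS, Nat.add_sub_cancel])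
      (fun a ha b hb hab => he (Finset.mem_of_mem_erase ha) (Finset.mem_of_mem_erase hb)
        (by simpa using hab))
      (strictMono_nat_of_lt_succ fun i => (hyI i).2.trans (hyI (i + 1)).1)
      (fun i => (hx0 i).trans (hyI i).1)
      (fun i hi => by
        rw [← hy0 i hi]
        simp only [hg']
        rw [← Finset.add_sum_erase S _ ha₀]
        simp [mul_assoc])
    have hz' : ∀ a ∈ S, a ≠ a₀ → c a = 0 := fun a ha hne => by
      refine (mul_eq_zero.1 (hz a (Finset.mem_erase.2 ⟨hne, ha⟩))).resolve_right ?_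
      exact sub_ne_zero.2 fun h => hne (he ha ha₀ h)
    intro a ha
    by_cases hne : a = a₀
    · have h0 := hf 0 (Nat.succ_pos n)
      rw [Finset.sum_eq_single_of_mem a₀ ha₀ fun b hb hb0 => by rw [hz' b hb hb0, zero_mul]] at h0
      rw [hne]
      exact (mul_eq_zero.1 h0).resolve_right (Real.rpow_pos_of_pos (hx0 0) _).ne'
    · exact hz' a ha hne

/-- Solutions of a generalized Vandermonde system are controlled by its right-hand side. -/
theorem exists_abs_le_of_vandermonde_system {m : ℕ} {σ : ℕ → ℝ}
    (hσ : Set.InjOn σ (Finset.Icc 1 m : Finset ℕ)) :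
    ∃ K : ℝ, 0 ≤ K ∧ ∀ (W b : ℕ → ℝ) (C : ℝ),
      (∀ r ∈ Finset.Icc 1 m, ∑ j ∈ Finset.Icc 1 m, W j * (j : ℝ) ^ σ r = b r) →
      (∀ r ∈ Finset.Icc 1 m, |b r| ≤ C) → ∀ j ∈ Finset.Icc 1 m, |W j| ≤ K * C := by
  set A : Matrix (Finset.Icc 1 m) (Finset.Icc 1 m) ℝ :=
    Matrix.of fun r j => ((j : ℕ) : ℝ) ^ σ r with hA
  have hdet : A.det ≠ 0 := fun h => by
    obtain ⟨v, hv0, hv⟩ := Matrix.exists_vecMul_eq_zero_iff.2 h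
    refine hv0 (funext fun a => ?_)
    refine eq_zero_of_sum_rpow_eq_zero m Finset.univ (fun r : Finset.Icc 1 m => σ r) v
      (fun i => (i : ℝ) + 1) (by simp) (fun a _ b _ hab => Subtype.ext (hσ a.2 b.2 hab))
      (fun i j hij => by simpa using hij) (fun i => by positivity) (fun i hi => ?_) a
      (Finset.mem_univ a)
    have := congrFun hv ⟨i + 1, Finset.mem_Icc.2 ⟨by omega, by omega⟩⟩
    simpa [Matrix.vecMul, dotProduct, hA] using this
  have hinv : A⁻¹ * A = 1 := Matrix.nonsing_inv_mul A (isUnit_iff_ne_zero.2 hdet)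
  refine ⟨∑ i, ∑ j, |A⁻¹ i j|, by positivity, fun W b C hW hb j hj => ?_⟩
  have h1 : A.mulVec (fun j => W j) = fun r : Finset.Icc 1 m => b r := funext fun r => by
    rw [← hW r r.2, ← Finset.sum_coe_sort]
    simp [Matrix.mulVec, dotProduct, hA, mul_comm]
  have h2 : W j = ∑ r, A⁻¹ ⟨j, hj⟩ r * b r := by
    have : A⁻¹.mulVec (A.mulVec fun j => W j) = fun j : Finset.Icc 1 m => W j := by
      rw [Matrix.mulVec_mulVec, hinv, Matrix.one_mulVec]
    rw [h1] at this
    exact (congrFun this ⟨j, hj⟩).symm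
  have hC : 0 ≤ C := (abs_nonneg _).trans (hb j hj)
  rw [h2]
  calc _ ≤ ∑ r, |A⁻¹ ⟨j, hj⟩ r| * C := by
        refine (Finset.abs_sum_le_sum_abs _ _).trans (Finset.sum_le_sum fun r _ => ?_)
        rw [abs_mul]
        exact mul_le_mul_of_nonneg_left (hb r r.2) (abs_nonneg _)
    _ = (∑ r, |A⁻¹ ⟨j, hj⟩ r|) * C := by rw [Finset.sum_mul]
    _ ≤ _ := mul_le_mul_of_nonneg_right
        (Finset.single_le_sum (f := fun i => ∑ r, |A⁻¹ i r|) (fun i _ => by positivity)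
          (Finset.mem_univ _)) hC

theorem exists_abs_startWeights_le {β : ℝ} (hβ0 : 0 < β) (hβ1 : β < 1) {m : ℕ} {σ : ℕ → ℝ}
    (hmono : StrictMonoOn σ (Set.Icc 1 m))
    (hσ : ∀ r ∈ Finset.Icc 1 m, 0 < σ r ∧ σ r ≤ 2 - β) {W : ℕ → ℕ → ℝ}
    (hW : ∀ n, IsStartWeights β σ m n (W n)) :
    ∃ C : ℝ, ∀ n, ∀ j ∈ Finset.Icc 1 m, |W n j| ≤ C := by
  obtain ⟨K, hK, h⟩ := exists_abs_le_of_vandermonde_system (m := m) (σ := σ)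
    (by simpa using hmono.injOn)
  have hb : ∀ r ∈ Finset.Icc 1 m, ∃ C : ℝ, ∀ n : ℕ,
      |Real.Gamma (σ r + 1) / Real.Gamma (σ r + 1 + β) * (n : ℝ) ^ (σ r + β) -
        ∑ j ∈ Finset.range (n + 1), omegaCoef β (n - j) * (j : ℝ) ^ (σ r)| ≤ C :=
    fun r hr => exists_abs_quadrature_error_le hβ0 hβ1 (hσ r hr).1.le (hσ r hr).2
  choose! C hC using hb
  refine ⟨K * ∑ r ∈ Finset.Icc 1 m, |C r|, fun n => h (W n) _ _ (hW n) fun r hr => ?_⟩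
  exact ((hC r hr n).trans (le_abs_self _)).trans
    (Finset.single_le_sum (f := fun r => |C r|) (fun i _ => abs_nonneg _) hr)

theorem exists_abs_extrapWeights_le {m : ℕ} {δ : ℕ → ℝ}
    (hmono : StrictMonoOn δ (Set.Icc 1 m))
    (hδ : ∀ r ∈ Finset.Icc 1 m, 0 < δ r ∧ δ r ≤ 2) {W : ℕ → ℕ → ℝ}
    (hW : ∀ n, 2 ≤ n → IsExtrapWeights δ m n (W n)) :
    ∃ C : ℝ, ∀ n, 2 ≤ n → ∀ j ∈ Finset.Icc 1 m, |W n j| ≤ C := by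
  obtain ⟨K, hK, h⟩ := exists_abs_le_of_vandermonde_system (m := m) (σ := δ)
    (by simpa using hmono.injOn)
  have hb : ∀ r ∈ Finset.Icc 1 m, ∃ C : ℝ, ∀ n : ℕ, 2 ≤ n →
      |(n : ℝ) ^ (δ r) - 2 * ((n : ℝ) - 1) ^ (δ r) + ((n : ℝ) - 2) ^ (δ r)| ≤ C :=
    fun r hr => exists_abs_second_difference_rpow_le (hδ r hr).1.le (hδ r hr).2
  choose! C hC using hb
  refine ⟨K * ∑ r ∈ Finset.Icc 1 m, |C r|, fun n hn => h (W n) _ _ (hW n hn) fun r hr => ?_⟩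
  exact ((hC r hr n hn).trans (le_abs_self _)).trans
    (Finset.single_le_sum (f := fun r => |C r|) (fun i _ => abs_nonneg _) hr)

theorem exists_abs_Bweight_le {β : ℝ} (hβ0 : 0 < β) (hβ1 : β < 1) {m : ℕ} {W : ℕ → ℕ → ℝ}
    {C : ℝ} (hW : ∀ n, ∀ j ∈ Finset.Icc 1 m, |W n j| ≤ C) :
    ∃ C' : ℝ, ∀ n, |Bweight β (omegaCoef β) (W n) m n| ≤ C' := by
  obtain ⟨D, hD⟩ := exists_abs_quadrature_error_le (s := 0) hβ0 hβ1 le_rfl (by linarith)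
  refine ⟨D + (Finset.Icc 1 m).card • C, fun n => ?_⟩
  have h := hD n
  simp only [zero_add, Real.Gamma_one, Real.rpow_zero, mul_one, one_div_mul_eq_div] at h
  rw [Bweight]
  refine (abs_sub _ _).trans (add_le_add h ?_)
  exact (Finset.abs_sum_le_sum_abs _ _).trans (Finset.sum_le_card_nsmul _ _ _ (hW n))

theorem mul_norm_evalAt_le_of_forall_lt {f g : PowerSeries ℂ} (hf : AbsSummable f)
    (hg : AbsSummable g) {c : ℝ}
    (h : ∀ z : ℂ, ‖z‖ < 1 → c * ‖evalAt z g‖ ≤ ‖evalAt z f‖) {z : ℂ} (hz : ‖z‖ ≤ 1) :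
    c * ‖evalAt z g‖ ≤ ‖evalAt z f‖ := by
  have hz' : z ∈ Metric.closedBall (0 : ℂ) 1 := by simpa using hz
  refine ContinuousWithinAt.closure_le (s := Metric.ball (0 : ℂ) 1)
    (f := fun z => c * ‖evalAt z g‖) (g := fun z => ‖evalAt z f‖) ?_ ?_ ?_
    fun y hy => h y (by simpa using hy)
  · rwa [closure_ball (0 : ℂ) one_ne_zero]
  · exact ((hg.continuousOn_evalAt.norm.const_mul c) z hz').mono Metric.ball_subset_closedBall
  · exact (hf.continuousOn_evalAt.norm z hz').mono Metric.ball_subset_closedBall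

theorem mul_one_sub_re_le_re_evalAt_risingSeries {β : ℝ} (hβ0 : 0 < β) (hβ1 : β < 1) {z : ℂ}
    (hz : ‖z‖ ≤ 1) : β * (1 - z.re) ≤ (evalAt z (risingSeries (-β))).re := by
  have hs := ((absSummable_risingSeries hβ0 hβ1).summableAt hz).of_norm
  have hre := Complex.hasSum_re hs.hasSum
  have hsum := summable_risingCoef_neg hβ0 hβ1
  have hle : ∑' n, -risingCoef (-β) (n + 1) ≤ 1 :=
    hsum.tsum_le_of_sum_range_le (sum_neg_risingCoef_le hβ1)
  rw [hsum.tsum_eq_zero_add] at hle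
  have h1 : risingCoef (-β) 1 = -β := by simp [risingCoef]
  have hsum2 := (summable_nat_add_iff 1).2 hsum
  have hre2 := (summable_nat_add_iff 2).2 hre.summable
  have hcmp : ∑' n, risingCoef (-β) (n + 2) ≤
      ∑' n, (PowerSeries.coeff (n + 2) (risingSeries (-β)) * z ^ (n + 2)).re := by
    refine Summable.tsum_le_tsum (fun n => ?_) (by simpa using hsum2.neg) hre2
    rw [coeff_risingSeries, Complex.re_ofReal_mul]
    have hn := risingCoef_neg_nonpos hβ0.le hβ1.le (n + 1)
    have hzn : (z ^ (n + 2)).re ≤ 1 := by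
      refine (Complex.re_le_norm _).trans ?_
      rw [norm_pow]
      exact pow_le_one₀ (norm_nonneg _) hz
    nlinarith
  have hev : (evalAt z (risingSeries (-β))).re = 1 - β * z.re +
      ∑' n, (PowerSeries.coeff (n + 2) (risingSeries (-β)) * z ^ (n + 2)).re := by
    rw [evalAt, ← hre.tsum_eq, ← hre.summable.sum_add_tsum_nat_add 2, Finset.sum_range_succ,
      Finset.sum_range_one, coeff_risingSeries, coeff_risingSeries, risingCoef_zero, h1]
    simp [sub_eq_add_neg]
  rw [tsum_neg] at hle
  simp only [zero_add, h1] at hle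
  rw [hev]
  linarith

theorem evalAt_risingSeries_ne_zero {β : ℝ} (hβ0 : 0 < β) (hβ1 : β < 1) {z : ℂ}
    (hz : ‖z‖ ≤ 1) (hz1 : z ≠ 1) : evalAt z (risingSeries (-β)) ≠ 0 := by
  have hre : z.re < 1 := by
    refine lt_of_le_of_ne ((Complex.re_le_norm z).trans hz) fun h => hz1 ?_
    have h2 : z.re * z.re + z.im * z.im ≤ 1 := by
      rw [← Complex.normSq_apply, Complex.normSq_eq_norm_sq]
      exact pow_le_one₀ (norm_nonneg _) hz
    refine Complex.ext h ?_
    rw [h] at h2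
    exact mul_self_eq_zero.1 (le_antisymm (by linarith) (mul_self_nonneg _))
  intro h
  have := mul_one_sub_re_le_re_evalAt_risingSeries hβ0 hβ1 hz
  rw [h, Complex.zero_re] at this
  nlinarith [mul_pos hβ0 (sub_pos.2 hre)]

theorem evalAt_one_risingSeries {β : ℝ} (hβ0 : 0 < β) (hβ1 : β < 1) :
    evalAt 1 (risingSeries (-β)) = 0 := by
  have hs := ((absSummable_risingSeries hβ0 hβ1).summableAt (z := 1) (by simp)).of_norm
  have h1 := hs.hasSum.tendsto_sum_nat.comp (tendsto_add_atTop_nat 1)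
  refine tendsto_nhds_unique h1 (((Complex.continuous_ofReal.tendsto _).comp
    (tendsto_risingCoef_zero hβ0 hβ1)).congr fun n => ?_)
  simp [← sum_risingCoef, coeff_risingSeries]

/-- The generating function of the characteristic equation of the scheme. -/
noncomputable def charSeries (β k : ℝ) (ξ : ℂ) : PowerSeries ℂ :=
  1 - PowerSeries.C ξ * (PowerSeries.C ((k : ℂ) + 1) * omegaSeries β -
    PowerSeries.C ((k : ℂ) * (omegaCoef β 0 : ℂ)) *
      ((1 - PowerSeries.X) * (1 - PowerSeries.X)))

theorem bddCoeff_omegaSeries {β : ℝ} (hβ0 : 0 < β) (hβ1 : β < 1) : BddCoeff (omegaSeries β) := by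
  rw [omegaSeries_eq hβ0]
  exact BddCoeff.mul_left ((absSummable_binSeries hβ0 hβ1).C_mul _)
    (bddCoeff_risingSeries (by linarith) hβ1.le)

section CharSeries

variable {β k : ℝ} {ξ : ℂ}

theorem summableAt_charSeries (hβ0 : 0 < β) (hβ1 : β < 1) {z : ℂ} (hz : ‖z‖ < 1) :
    SummableAt z (charSeries β k ξ) := by
  have hX := summableAt_one_sub_X z
  exact (summableAt_one z).sub (((((bddCoeff_omegaSeries hβ0 hβ1).summableAt hz).C_mul _).sub
    ((hX.mul hX).C_mul _)).C_mul _)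

theorem evalAt_charSeries (hβ0 : 0 < β) (hβ1 : β < 1) {z : ℂ} (hz : ‖z‖ < 1) :
    evalAt z (charSeries β k ξ) = 1 - ξ * (((k : ℂ) + 1) * omegaFnC β z -
      (k : ℂ) * (omegaCoef β 0 : ℂ) * (1 - z) ^ 2) := by
  have hX := summableAt_one_sub_X z
  have hΩ := (bddCoeff_omegaSeries hβ0 hβ1).summableAt hz
  have he : evalAt z (omegaSeries β) = omegaFnC β z := by
    simp [evalAt, omegaFnC, omegaSeries]
  rw [charSeries, evalAt_sub (summableAt_one z)
    (((hΩ.C_mul _).sub ((hX.mul hX).C_mul _)).C_mul _), evalAt_C_mul,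
    evalAt_sub (hΩ.C_mul _) ((hX.mul hX).C_mul _), evalAt_C_mul, evalAt_C_mul, evalAt_mul hX hX,
    evalAt_one, evalAt_one_sub_X, he, sq]

theorem risingSeries_mul_charSeries (hβ0 : 0 < β) :
    risingSeries (-β) * charSeries β k ξ = risingSeries (-β) - PowerSeries.C ξ *
      (PowerSeries.C ((k : ℂ) + 1) * (PowerSeries.C ((2 ^ (-β) : ℝ) : ℂ) * binSeries β) -
        PowerSeries.C ((k : ℂ) * (omegaCoef β 0 : ℂ)) *
          (risingSeries (-β) * ((1 - PowerSeries.X) * (1 - PowerSeries.X)))) := by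
  have h : risingSeries (-β) * risingSeries β = 1 := by
    rw [← risingSeries_add, neg_add_cancel, risingSeries_zero]
  rw [charSeries, omegaSeries_eq hβ0]
  linear_combination -(PowerSeries.C ξ * PowerSeries.C ((k : ℂ) + 1) *
    (PowerSeries.C ((2 ^ (-β) : ℝ) : ℂ) * binSeries β)) * h

theorem bddCoeff_of_charSeries_mul (hβ0 : 0 < β) (hβ1 : β < 1) {c : ℝ} (hc : 0 < c)
    (hinf : ∀ z : ℂ, ‖z‖ < 1 → c ≤ ‖evalAt z (charSeries β k ξ)‖) {u : PowerSeries ℂ}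
    (hu : BddCoeff (charSeries β k ξ * u)) : BddCoeff u := by
  have hX := AbsSummable.one_sub_X
  by_cases h0 : ξ * ((k : ℂ) + 1) = 0
  · have hΦ : AbsSummable (charSeries β k ξ) := by
      have : charSeries β k ξ = 1 - PowerSeries.C ξ * (0 - PowerSeries.C ((k : ℂ) *
          (omegaCoef β 0 : ℂ)) * ((1 - PowerSeries.X) * (1 - PowerSeries.X))) := by
        have h1 : PowerSeries.C ξ * PowerSeries.C ((k : ℂ) + 1) = 0 := by
          rw [← map_mul, h0, map_zero]
        rw [charSeries]
        linear_combination (-omegaSeries β) * h1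
      rw [this, zero_sub, mul_neg, sub_neg_eq_add]
      exact AbsSummable.one.add (((hX.mul hX).C_mul _).C_mul _)
    refine bddCoeff_of_mul_bddCoeff hΦ (fun z hz h => ?_) hu
    have := mul_norm_evalAt_le_of_forall_lt hΦ AbsSummable.one (c := c)
      (fun w hw => by simpa [evalAt_one] using hinf w hw) hz
    rw [evalAt_one, norm_one, mul_one] at this
    exact absurd (this.trans_eq (norm_eq_zero.2 h)) (not_le.2 hc)
  · have hD := absSummable_risingSeries hβ0 hβ1
    have hA := (absSummable_binSeries hβ0 hβ1).C_mul ((2 ^ (-β) : ℝ) : ℂ)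
    have hF : AbsSummable (risingSeries (-β) * charSeries β k ξ) := by
      rw [risingSeries_mul_charSeries hβ0]
      exact hD.sub (((hA.C_mul _).sub ((hD.mul (hX.mul hX)).C_mul _)).C_mul _)
    refine bddCoeff_of_mul_bddCoeff hF (fun z hz h => ?_) (by
      rw [mul_assoc]
      exact BddCoeff.mul_left hD hu)
    by_cases hz1 : z = 1
    · have s1 := summableAt_one_sub_X 1
      have sD := hD.summableAt hz
      have sA := hA.summableAt hz
      subst hz1
      have h2 : (2 : ℝ) ^ (-β) * 2 ^ β = 1 := by
        rw [← Real.rpow_add (by norm_num), neg_add_cancel, Real.rpow_zero]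
      have h3 : evalAt 1 (risingSeries (-β) * charSeries β k ξ) = -(ξ * ((k : ℂ) + 1)) := by
        rw [risingSeries_mul_charSeries hβ0, evalAt_sub sD
          (((sA.C_mul _).sub ((sD.mul (s1.mul s1)).C_mul _)).C_mul _), evalAt_C_mul,
          evalAt_sub (sA.C_mul _) ((sD.mul (s1.mul s1)).C_mul _), evalAt_C_mul, evalAt_C_mul,
          evalAt_C_mul, evalAt_mul sD (s1.mul s1), evalAt_one_risingSeries hβ0 hβ1,
          evalAt_one_binSeries hβ0 hβ1, ← Complex.ofReal_mul, h2]
        simp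
      exact h0 (neg_eq_zero.1 (h3.symm.trans h))
    · have := mul_norm_evalAt_le_of_forall_lt hF hD (c := c) (fun w hw => by
        rw [evalAt_mul (hD.summableAt hw.le) (summableAt_charSeries hβ0 hβ1 hw), norm_mul,
          mul_comm]
        exact mul_le_mul_of_nonneg_left (hinf w hw) (norm_nonneg _)) hz
      refine absurd (this.trans_eq (norm_eq_zero.2 h)) (not_le.2 (mul_pos hc ?_))
      exact norm_pos_iff.2 (evalAt_risingSeries_ne_zero hβ0 hβ1 hz hz1)

theorem coeff_charSeries_mul (U : ℕ → ℂ) {n : ℕ} (hn : 2 ≤ n) :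
    PowerSeries.coeff n (charSeries β k ξ * PowerSeries.mk U) =
      U n - ξ * (((k : ℂ) + 1) * ∑ j ∈ Finset.range (n + 1), (omegaCoef β (n - j) : ℂ) * U j -
        (k : ℂ) * (omegaCoef β 0 : ℂ) * (U n - 2 * U (n - 1) + U (n - 2))) := by
  have h : charSeries β k ξ * PowerSeries.mk U = PowerSeries.mk U - PowerSeries.C ξ *
      (PowerSeries.C ((k : ℂ) + 1) * (PowerSeries.mk U * omegaSeries β) -
        PowerSeries.C ((k : ℂ) * (omegaCoef β 0 : ℂ)) *
          ((1 - PowerSeries.X) ^ 2 * PowerSeries.mk U)) := by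
    rw [charSeries]
    ring
  rw [h, map_sub, PowerSeries.coeff_C_mul, map_sub, PowerSeries.coeff_C_mul,
    PowerSeries.coeff_C_mul, coeff_sq_one_sub_X_mul _ _ hn, PowerSeries.coeff_mul,
    Finset.Nat.sum_antidiagonal_eq_sum_range_succ_mk]
  simp only [PowerSeries.coeff_mk, omegaSeries, mul_comm (U _)]

end CharSeries

theorem norm_sum_ofReal_mul_le {s : Finset ℕ} {W : ℕ → ℝ} {V : ℕ → ℂ} {C : ℝ}
    (hW : ∀ j ∈ s, |W j| ≤ C) :
    ‖∑ j ∈ s, (W j : ℂ) * V j‖ ≤ ∑ j ∈ s, C * ‖V j‖ := by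
  refine norm_sum_le_of_le _ fun j hj => ?_
  rw [norm_mul, Complex.norm_real, Real.norm_eq_abs]
  exact mul_le_mul_of_nonneg_right (hW j hj) (norm_nonneg _)

end PowerSeriesStability

/-- Theorem 3.3: linear stability of the IMEX-E scheme for the test equation
`^CD_0^β u = λu + ρu` with `ρ = kλ` treated explicitly.  If `ξ = λh^β` keeps
`1 − ξ((k+1)ω^{(β)}(z) − kω_0^{(β)}(1−z)²)` away from zero on the unit disk,
the numerical solution is bounded for every choice of starting values. -/
theorem imexE_linear_stability (β : ℝ) (hβ0 : 0 < β) (hβ1 : β < 1)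
    (lam ρ : ℂ) (k : ℝ) (hρ : ρ = (k : ℂ) * lam) (h : ℝ) (hh : 0 < h)
    (mu mtf : ℕ) (σ δ : ℕ → ℝ)
    (hσmono : StrictMonoOn σ (Set.Icc 1 mu))
    (hσ : ∀ r ∈ Finset.Icc 1 mu, 0 < σ r ∧ σ r ≤ 2 - β)
    (hδmono : StrictMonoOn δ (Set.Icc 1 mtf))
    (hδ : ∀ r ∈ Finset.Icc 1 mtf, 0 < δ r ∧ δ r ≤ 2 - β)
    (Wσ Wh : ℕ → ℕ → ℝ)
    (hWσ : ∀ n : ℕ, IsStartWeights β σ mu n (Wσ n))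
    (hWh : ∀ n : ℕ, 2 ≤ n → IsExtrapWeights δ mtf n (Wh n))
    (c : ℝ) (hc : 0 < c)
    (hinf : ∀ z : ℂ, ‖z‖ < 1 →
      c ≤ ‖1 - lam * ((h ^ β : ℝ) : ℂ) *
        (((k : ℂ) + 1) * omegaFnC β z -
          (k : ℂ) * (omegaCoef β 0 : ℂ) * (1 - z) ^ 2)‖)
    (U : ℕ → ℂ)
    (hU : ∀ n : ℕ, max 2 (max mu mtf + 1) ≤ n →
      U n = U 0 + (lam + ρ) * ((h ^ β : ℝ) : ℂ) *
          ((∑ j ∈ Finset.range (n + 1), (omegaCoef β (n - j) : ℂ) * U j) +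
            (∑ j ∈ Finset.Icc 1 mu, (Wσ n j : ℂ) * U j) +
            (Bweight β (omegaCoef β) (Wσ n) mu n : ℂ) * U 0) +
        ρ * ((h ^ β : ℝ) : ℂ) * (omegaCoef β 0 : ℂ) *
          (-U n + 2 * U (n - 1) - U (n - 2) +
            ∑ j ∈ Finset.Icc 1 mtf, (Wh n j : ℂ) * (U j - U 0))) :
    ∃ M : ℝ, ∀ n : ℕ, ‖U n‖ ≤ M := by
  obtain ⟨Cσ, hCσ⟩ := exists_abs_startWeights_le hβ0 hβ1 hσmono hσ hWσ
  obtain ⟨Ch, hCh⟩ := exists_abs_extrapWeights_le hδmono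
    (fun r hr => ⟨(hδ r hr).1, (hδ r hr).2.trans (by linarith)⟩) hWh
  obtain ⟨CB, hCB⟩ := exists_abs_Bweight_le hβ0 hβ1 hCσ
  set ξ : ℂ := lam * ((h ^ β : ℝ) : ℂ) with hξ
  have hbdd : BddCoeff (charSeries β k ξ * PowerSeries.mk U) := by
    refine BddCoeff.of_isBigO (Asymptotics.IsBigO.of_bound
      (‖U 0‖ + ‖ξ * ((k : ℂ) + 1)‖ * (∑ j ∈ Finset.Icc 1 mu, Cσ * ‖U j‖ + CB * ‖U 0‖) +
        ‖ξ * k * (omegaCoef β 0 : ℂ)‖ * ∑ j ∈ Finset.Icc 1 mtf, Ch * ‖U j - U 0‖) ?_)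
    filter_upwards [Filter.eventually_ge_atTop (max 2 (max mu mtf + 1))] with n hn
    have hn2 : 2 ≤ n := (le_max_left _ _).trans hn
    have e : PowerSeries.coeff n (charSeries β k ξ * PowerSeries.mk U) =
        U 0 + ξ * ((k : ℂ) + 1) * ((∑ j ∈ Finset.Icc 1 mu, (Wσ n j : ℂ) * U j) +
          (Bweight β (omegaCoef β) (Wσ n) mu n : ℂ) * U 0) +
        ξ * k * (omegaCoef β 0 : ℂ) *
          ∑ j ∈ Finset.Icc 1 mtf, (Wh n j : ℂ) * (U j - U 0) := by
      rw [coeff_charSeries_mul U hn2]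
      have := hU n hn
      rw [hρ] at this
      rw [hξ]
      linear_combination this
    rw [e, norm_one, mul_one]
    refine norm_add_le_of_le (norm_add_le_of_le le_rfl ?_) ?_
    · rw [norm_mul]
      refine mul_le_mul_of_nonneg_left (norm_add_le_of_le (norm_sum_ofReal_mul_le (hCσ n)) ?_)
        (norm_nonneg _)
      rw [norm_mul, Complex.norm_real, Real.norm_eq_abs]
      exact mul_le_mul_of_nonneg_right (hCB n) (norm_nonneg _)
    · rw [norm_mul]
      exact mul_le_mul_of_nonneg_left (norm_sum_ofReal_mul_le (hCh n hn2)) (norm_nonneg _)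
  obtain ⟨M, hM⟩ := bddCoeff_of_charSeries_mul hβ0 hβ1 hc
    (fun z hz => by rw [evalAt_charSeries hβ0 hβ1 hz]; exact hinf z hz) hbdd
  exact ⟨M, fun n => by simpa using hM n⟩
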